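/- arXiv:2004.07335 — 8 statements merged into one kernel-verified Lean document; each statement's English description precedes it below -/
import Mathlib

section
/- Let a and b be two coprime positive integers with b ≥ 2. Then for every integer n ≥ b + 1, we have lcm(a, a+b, a+2b, …, a+nb) ≤ (41.30142 · b · log b)^(n + ⌊a/b⌋). -/
/-- `L a b n` is the least common multiple of `a, a+b, a+2b, …, a+nb`. -/
def L (a b n : ℕ) : ℕ := Finset.lcm (Finset.range (n + 1)) (fun k => a + k * b)

section

open Finset Nat Chebyshev

lemma lcmUpto_add_dvd {m k : ℕ} (hkm : k ≤ m) :
    lcmUpto (m + k) ∣ lcmUpto m * (m + k).choose k := by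
  have hc : (m + k).choose k ≠ 0 := (Nat.choose_pos (Nat.le_add_left k m)).ne'
  rw [← Nat.factorization_prime_le_iff_dvd (lcmUpto_ne_zero _) (mul_ne_zero (lcmUpto_ne_zero _) hc)]
  intro p hp
  rw [Nat.factorization_mul (lcmUpto_ne_zero _) hc, Finsupp.add_apply, factorization_lcmUpto _ hp,
    factorization_lcmUpto _ hp, Nat.factorization_choose' hp (Nat.lt_succ_self _)]
  have hsub : Finset.Ico (p.log m + 1) (p.log (m + k) + 1) ⊆
      {i ∈ Finset.Ico 1 (p.log (m + k)).succ | p ^ i ≤ k % p ^ i + m % p ^ i} := by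
    intro i hi
    simp only [Finset.mem_Ico, Finset.mem_filter] at hi ⊢
    have hlt : m < p ^ i := Nat.lt_pow_of_log_lt hp.one_lt (by omega)
    have hle : p ^ i ≤ m + k := Nat.pow_le_of_le_log (by
      rintro h
      have : p ^ i > 0 := pow_pos hp.pos _
      have : p.log (m + k) = 0 := by simp [h]
      omega) (by omega)
    rw [Nat.mod_eq_of_lt hlt, Nat.mod_eq_of_lt (hkm.trans_lt hlt)]
    omega
  have := Finset.card_le_card hsub
  rw [Nat.card_Ico] at this
  omega

lemma lcmUpto_le_four_pow (n : ℕ) : lcmUpto n ≤ 4 ^ n := by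
  induction n using Nat.strong_induction_on with
  | _ n ih =>
    rcases lt_or_ge n 2 with hn | hn
    · interval_cases n <;> decide
    · have h4 : (4 : ℕ) = 2 ^ 2 := rfl
      obtain ⟨m, rfl | rfl⟩ := Nat.even_or_odd' n
      · calc lcmUpto (2 * m) = lcmUpto (m + m) := by rw [two_mul]
          _ ≤ lcmUpto m * (m + m).choose m :=
            Nat.le_of_dvd (mul_pos (lcmUpto_pos _) (Nat.choose_pos (by omega)))
              (lcmUpto_add_dvd le_rfl)
          _ ≤ 4 ^ m * 2 ^ (m + m) := Nat.mul_le_mul (ih m (by omega)) (Nat.choose_le_two_pow _ _)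
          _ = 4 ^ (2 * m) := by rw [h4, ← pow_mul, ← pow_mul, ← pow_add]; congr 1; ring
      · calc lcmUpto (2 * m + 1) = lcmUpto (m + 1 + m) := by congr 1; ring
          _ ≤ lcmUpto (m + 1) * (m + 1 + m).choose m :=
            Nat.le_of_dvd (mul_pos (lcmUpto_pos _) (Nat.choose_pos (by omega)))
              (lcmUpto_add_dvd (by omega))
          _ ≤ 4 ^ (m + 1) * 4 ^ m := Nat.mul_le_mul (ih _ (by omega)) (by
              rw [show m + 1 + m = 2 * m + 1 by ring]; exact Nat.choose_middle_le_pow m)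
          _ = 4 ^ (2 * m + 1) := by ring

lemma factorization_add_mul_eq_zero {a b p k : ℕ} (hab : a.Coprime b) (hp : p.Prime)
    (hpb : p ∣ b) : (a + k * b).factorization p = 0 := by
  refine Nat.factorization_eq_zero_of_not_dvd fun h => ?_
  exact Nat.not_coprime_of_dvd_of_dvd hp.one_lt
    ((Nat.dvd_add_left (hpb.mul_left k)).1 h) hpb hab

lemma exists_dvd_add_mul {b p : ℕ} (a : ℕ) {f N : ℕ} (hp : p.Prime) (hpb : ¬ p ∣ b)
    (hf : p ^ f ≤ N + 1) : ∃ k ≤ N, p ^ f ∣ a + k * b := by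
  have hpos : 0 < p ^ f := pow_pos hp.pos _
  have hcop : b.Coprime (p ^ f) := (((Nat.Prime.coprime_iff_not_dvd hp).2 hpb).pow_left f).symm
  have : NeZero (p ^ f) := ⟨hpos.ne'⟩
  let u := ZMod.unitOfCoprime b hcop
  refine ⟨(-(a : ZMod (p ^ f)) * ((u⁻¹ : (ZMod (p ^ f))ˣ) : ZMod (p ^ f))).val, ?_, ?_⟩
  · have := ZMod.val_lt (-(a : ZMod (p ^ f)) * ((u⁻¹ : (ZMod (p ^ f))ˣ) : ZMod (p ^ f)))
    omega
  · rw [← ZMod.natCast_eq_zero_iff]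
    push_cast
    rw [ZMod.natCast_zmod_val]
    have hu : ((u : (ZMod (p ^ f))ˣ) : ZMod (p ^ f)) = b := ZMod.coe_unitOfCoprime b hcop
    rw [← hu, mul_assoc, Units.inv_mul]
    ring

lemma factorization_sub_index_le {a b p k j e f : ℕ} (ha : 0 < a) (hp : p.Prime)
    (he : p ^ e ∣ a + k * b) (hfe : f ≤ e) {d : ℕ} (hdf : d.factorization p ≤ f)
    (hjk : k = j + d ∨ j = k + d) :
    d.factorization p ≤ (a + j * b).factorization p := by
  rw [← hp.pow_dvd_iff_le_factorization (by positivity)]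
  have h1 : p ^ d.factorization p ∣ a + k * b := (pow_dvd_pow p (hdf.trans hfe)).trans he
  have h2 : p ^ d.factorization p ∣ d * b := (Nat.ordProj_dvd d p).mul_right b
  rcases hjk with rfl | rfl
  · rw [add_mul, ← add_assoc] at h1
    exact (Nat.dvd_add_left h2).1 h1
  · rw [add_mul, ← add_assoc]
    exact dvd_add h1 h2

lemma factorization_factorial_eq_sum (m p : ℕ) :
    (m !).factorization p = ∑ i ∈ range m, (i + 1).factorization p := by
  rw [← Finset.prod_range_add_one_eq_factorial, Nat.factorization_prod_apply (by simp)]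

lemma L_ne_zero {a : ℕ} (ha : 0 < a) (b N : ℕ) : L a b N ≠ 0 := by
  rw [L, Ne, Finset.lcm_eq_zero_iff]
  simp; omega

lemma factorization_L_add_factorial_le {a b p N : ℕ} (ha : 0 < a) (hp : p.Prime) (hpb : ¬ p ∣ b)
    (hN : N ≠ 0) :
    (L a b N).factorization p + (N !).factorization p ≤
      (∏ k ∈ range (N + 1), (a + k * b)).factorization p + p.log N := by
  obtain ⟨k, hk, hkL⟩ : ∃ k ∈ range (N + 1),
      (L a b N).factorization p = (a + k * b).factorization p := by
    rw [L, Finset.factorization_lcm (fun _ _ => by positivity)]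
    obtain ⟨k, hk, h⟩ := Finset.exists_mem_eq_sup (range (N + 1)) ⟨0, by simp⟩
      (fun k => (a + k * b).factorization p)
    exact ⟨k, hk, h⟩
  set e := (a + k * b).factorization p
  have hkN : k ≤ N := by simpa [Nat.lt_succ_iff] using hk
  have hfe : p.log N ≤ e := by
    obtain ⟨j, hj, hdvd⟩ := exists_dvd_add_mul a hp hpb
      ((Nat.pow_log_le_self p hN).trans (Nat.le_succ N))
    rw [hp.pow_dvd_iff_le_factorization (by positivity)] at hdvd
    refine hdvd.trans ?_
    rw [← hkL]
    have : a + j * b ∣ L a b N :=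
      Finset.dvd_lcm (f := fun k => a + k * b) (mem_range.2 (Nat.lt_succ_of_le hj))
    refine (Nat.factorization_le_iff_dvd (by positivity) (L_ne_zero ha b N)).2 this p
  have hpe : p ^ e ∣ a + k * b := Nat.ordProj_dvd _ _
  have hd : ∀ d, d ≠ 0 → d ≤ N → d.factorization p ≤ p.log N := fun d hd hdN =>
    Nat.le_log_of_pow_le hp.one_lt ((Nat.ordProj_le p hd).trans hdN)
  have hprod : (∏ k ∈ range (N + 1), (a + k * b)).factorization p =
      (∑ j ∈ range k, (a + j * b).factorization p) + e +
        ∑ i ∈ range (N - k), (a + (k + (i + 1)) * b).factorization p := by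
    rw [Nat.factorization_prod_apply (fun _ _ => by positivity),
      show N + 1 = (k + 1) + (N - k) by omega, Finset.sum_range_add, Finset.sum_range_succ]
    congr 1
    refine Finset.sum_congr rfl fun i _ => ?_
    rw [add_assoc k, add_comm 1 i]
  have hleft : (k !).factorization p ≤ ∑ j ∈ range k, (a + j * b).factorization p := by
    rw [factorization_factorial_eq_sum, ← Finset.sum_range_reflect]
    refine Finset.sum_le_sum fun j hj => ?_
    have := mem_range.1 hj
    exact factorization_sub_index_le ha hp hpe hfe (hd _ (by omega) (by omega))
      (Or.inl (by omega))
  have hright : ((N - k)!).factorization p ≤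
      ∑ i ∈ range (N - k), (a + (k + (i + 1)) * b).factorization p := by
    rw [factorization_factorial_eq_sum]
    refine Finset.sum_le_sum fun i hi => ?_
    have := mem_range.1 hi
    exact factorization_sub_index_le ha hp hpe hfe (hd _ (by omega) (by omega))
      (Or.inr rfl)
  have hfac : (N !).factorization p =
      (N.choose k).factorization p + (k !).factorization p + ((N - k)!).factorization p := by
    rw [← Nat.choose_mul_factorial_mul_factorial hkN,
      Nat.factorization_mul (mul_ne_zero (Nat.choose_pos hkN).ne' (factorial_ne_zero _))
        (factorial_ne_zero _),
      Nat.factorization_mul (Nat.choose_pos hkN).ne' (factorial_ne_zero _)]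
    rfl
  have hch : (N.choose k).factorization p ≤ p.log N := Nat.factorization_choose_le_log
  omega

lemma L_mul_factorial_dvd {a b N : ℕ} (ha : 0 < a) (hb : b ≠ 0) (hab : a.Coprime b)
    (hN : N ≠ 0) :
    L a b N * N ! ∣ (∏ k ∈ range (N + 1), (a + k * b)) * lcmUpto N *
      ∏ p ∈ b.primeFactors, p ^ (N !).factorization p := by
  have hL := L_ne_zero ha b N
  have hP : ∏ k ∈ range (N + 1), (a + k * b) ≠ 0 := by positivity
  have hD := lcmUpto_ne_zero N
  have hQ : ∏ p ∈ b.primeFactors, p ^ (N !).factorization p ≠ 0 :=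
    Finset.prod_ne_zero_iff.2 fun p hp => pow_ne_zero _ (Nat.prime_of_mem_primeFactors hp).ne_zero
  rw [← Nat.factorization_prime_le_iff_dvd (mul_ne_zero hL (factorial_ne_zero _))
    (mul_ne_zero (mul_ne_zero hP hD) hQ)]
  intro p hp
  rw [Nat.factorization_mul hL (factorial_ne_zero _), Nat.factorization_mul (mul_ne_zero hP hD) hQ,
    Nat.factorization_mul hP hD]
  simp only [Finsupp.add_apply]
  by_cases hpb : p ∣ b
  · have h0 : (L a b N).factorization p = 0 := by
      rw [L, Finset.factorization_lcm (fun _ _ => by positivity)]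
      simp [factorization_add_mul_eq_zero hab hp hpb]
    have hdvd : p ^ (N !).factorization p ∣ ∏ p ∈ b.primeFactors, p ^ (N !).factorization p :=
      Finset.dvd_prod_of_mem (fun p => p ^ (N !).factorization p)
        (Nat.mem_primeFactors.2 ⟨hp, hpb, hb⟩)
    rw [hp.pow_dvd_iff_le_factorization hQ] at hdvd
    omega
  · have := factorization_L_add_factorial_le ha hp hpb hN
    rw [factorization_lcmUpto _ hp]
    omega

lemma sum_primeFactors_log_div_le {b n : ℕ} (hb : b ≠ 0) (hn : 0 < n) :
    ∑ p ∈ b.primeFactors, Real.log p / ((p : ℝ) - 1) ≤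
      Real.log b / n + ∑ p ∈ primesLE n, Real.log p * (1 / ((p : ℝ) - 1) - 1 / n) := by
  have hn' : (0 : ℝ) < n := by exact_mod_cast hn
  have hlog : ∑ p ∈ b.primeFactors, Real.log p ≤ Real.log b := by
    rw [← Real.log_prod (fun p hp => by
      exact_mod_cast (Nat.prime_of_mem_primeFactors hp).ne_zero)]
    have hpos : 0 < ∏ p ∈ b.primeFactors, p :=
      Finset.prod_pos fun p hp => (Nat.prime_of_mem_primeFactors hp).pos
    have hle := Nat.le_of_dvd (Nat.pos_of_ne_zero hb) (Nat.prod_primeFactors_dvd b)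
    rw [← Nat.cast_prod]
    exact Real.log_le_log (by exact_mod_cast hpos) (by exact_mod_cast hle)
  have hterm : ∀ p ∈ primesLE n, 0 ≤ Real.log p * (1 / ((p : ℝ) - 1) - 1 / n) := by
    intro p hp
    have hpp := Nat.prime_of_mem_primesLE hp
    have h2 : (2 : ℝ) ≤ p := by exact_mod_cast hpp.two_le
    have hpn : (p : ℝ) ≤ n := by exact_mod_cast (Nat.mem_primesLE.1 hp).1
    refine mul_nonneg (Real.log_nonneg (by linarith)) (sub_nonneg.2 ?_)
    exact one_div_le_one_div_of_le (by linarith) (by linarith)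
  have hsplit : ∑ p ∈ b.primeFactors, Real.log p * (1 / ((p : ℝ) - 1) - 1 / n) ≤
      ∑ p ∈ primesLE n, Real.log p * (1 / ((p : ℝ) - 1) - 1 / n) := by
    rw [← Finset.sum_filter_add_sum_filter_not b.primeFactors (· ≤ n)]
    have h1 : ∑ p ∈ b.primeFactors with p ≤ n, Real.log p * (1 / ((p : ℝ) - 1) - 1 / n) ≤
        ∑ p ∈ primesLE n, Real.log p * (1 / ((p : ℝ) - 1) - 1 / n) := by
      refine Finset.sum_le_sum_of_subset_of_nonneg (fun p hp => ?_) fun p hp _ => hterm p hp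
      rw [Finset.mem_filter] at hp
      exact Nat.mem_primesLE.2 ⟨hp.2, Nat.prime_of_mem_primeFactors hp.1⟩
    have h2 : ∑ p ∈ b.primeFactors with ¬ p ≤ n,
        Real.log p * (1 / ((p : ℝ) - 1) - 1 / n) ≤ 0 := by
      refine Finset.sum_nonpos fun p hp => ?_
      rw [Finset.mem_filter, not_le] at hp
      have hpn : (n : ℝ) + 1 ≤ p := by exact_mod_cast hp.2
      refine mul_nonpos_of_nonneg_of_nonpos (Real.log_nonneg (by linarith)) (sub_nonpos.2 ?_)
      exact one_div_le_one_div_of_le hn' (by linarith)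
    linarith
  have hsum : ∑ p ∈ b.primeFactors, Real.log p / ((p : ℝ) - 1) =
      (∑ p ∈ b.primeFactors, Real.log p) / n +
        ∑ p ∈ b.primeFactors, Real.log p * (1 / ((p : ℝ) - 1) - 1 / n) := by
    rw [Finset.sum_div, ← Finset.sum_add_distrib]
    exact Finset.sum_congr rfl fun p _ => by ring
  rw [hsum]
  gcongr

lemma sum_primesLE_div_mul_log_le_log_factorial (n : ℕ) :
    ∑ p ∈ primesLE n, ((n / p : ℕ) : ℝ) * Real.log p ≤ Real.log (n ! : ℕ) := by
  have hsupp : primesLE n = (n !).primeFactors := by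
    ext p
    rw [Nat.mem_primesLE, Nat.mem_primeFactors]
    constructor
    · rintro ⟨h, hp⟩
      exact ⟨hp, (hp.dvd_factorial).2 h, factorial_ne_zero _⟩
    · rintro ⟨hp, h, -⟩
      exact ⟨(hp.dvd_factorial).1 h, hp⟩
  have hfac : (n ! : ℕ) = ∏ p ∈ (n !).primeFactors, p ^ (n !).factorization p :=
    Nat.prod_primeFactors_pow_factorization (factorial_ne_zero n)
  have hlog : Real.log (n ! : ℕ) = ∑ p ∈ primesLE n, ((n !).factorization p : ℝ) * Real.log p := by
    conv_lhs => rw [hfac]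
    rw [Nat.cast_prod, Real.log_prod (fun p hp => by
      exact_mod_cast pow_ne_zero _ (Nat.prime_of_mem_primeFactors hp).ne_zero), hsupp]
    exact Finset.sum_congr rfl fun p _ => by rw [Nat.cast_pow, Real.log_pow]
  rw [hlog]
  refine Finset.sum_le_sum fun p hp => ?_
  obtain ⟨hpn, hpp⟩ := Nat.mem_primesLE.1 hp
  refine mul_le_mul_of_nonneg_right ?_ (Real.log_nonneg (by exact_mod_cast hpp.one_lt.le))
  norm_cast
  rw [Nat.factorization_factorial hpp (Nat.lt_succ_self _)]
  have := Finset.single_le_sum (f := fun i => n / p ^ i) (s := Finset.Ico 1 (p.log n).succ)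
    (fun _ _ => Nat.zero_le _) (Finset.mem_Ico.2
      ⟨le_rfl, Nat.succ_lt_succ (Nat.log_pos hpp.one_lt hpn)⟩)
  simpa using this

lemma sum_primesLE_log_mul_le {n : ℕ} (hn : 0 < n) :
    ∑ p ∈ primesLE n, Real.log p * (1 / ((p : ℝ) - 1) - 1 / n) ≤
      Real.log (n ! : ℕ) / n + ∑ p ∈ primesLE n, Real.log p / (p * ((p : ℝ) - 1)) := by
  have hn' : (0 : ℝ) < n := by exact_mod_cast hn
  have h : ∑ p ∈ primesLE n, Real.log p * (1 / ((p : ℝ) - 1) - 1 / n) ≤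
      (∑ p ∈ primesLE n, ((n / p : ℕ) : ℝ) * Real.log p) / n +
        ∑ p ∈ primesLE n, Real.log p / (p * ((p : ℝ) - 1)) := by
    rw [Finset.sum_div, ← Finset.sum_add_distrib]
    refine Finset.sum_le_sum fun p hp => ?_
    have hpp := Nat.prime_of_mem_primesLE hp
    have h2 : (2 : ℝ) ≤ p := by exact_mod_cast hpp.two_le
    have hdiv : (n : ℝ) / p - 1 ≤ ((n / p : ℕ) : ℝ) := by
      have := (Nat.lt_floor_add_one ((n : ℝ) / p)).le
      rw [Nat.floor_div_eq_div] at this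
      linarith
    have hlog : 0 ≤ Real.log p := Real.log_nonneg (by linarith)
    have h1 : (1 / ((p : ℝ) - 1) - 1 / n) = (n / p - 1) / n + 1 / (p * ((p : ℝ) - 1)) := by
      have : (p : ℝ) - 1 ≠ 0 := by linarith
      field_simp
      ring
    calc Real.log p * (1 / ((p : ℝ) - 1) - 1 / n)
        = (n / p - 1) * Real.log p / n + Real.log p / (p * ((p : ℝ) - 1)) := by rw [h1]; ring
      _ ≤ _ := by gcongr
  refine h.trans ?_
  gcongr
  exact sum_primesLE_div_mul_log_le_log_factorial n

lemma sum_Ioc_log_div_le {n : ℕ} (hn : 4 ≤ n) :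
    ∑ m ∈ Finset.Ioc 4 n, Real.log m / (m * ((m : ℝ) - 1)) ≤
      (Real.log 5 + 1) / 4 - (Real.log (n + 1) + 1) / n := by
  induction n, hn using Nat.le_induction with
  | base => norm_num
  | succ n hn ih =>
    rw [← Finset.insert_Ioc_right_eq_Ioc_add_one (by omega), Finset.sum_insert (by simp)]
    have hn' : (4 : ℝ) ≤ n := by exact_mod_cast hn
    have hlog : Real.log (n + 1 + 1) ≤ Real.log (n + 1) + 1 / (n + 1) := by
      have := Real.log_le_sub_one_of_pos (x := ((n : ℝ) + 1 + 1) / (n + 1)) (by positivity)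
      rw [Real.log_div (by positivity) (by positivity)] at this
      have h2 : ((n : ℝ) + 1 + 1) / (n + 1) - 1 = 1 / (n + 1) := by field_simp; ring
      linarith
    have key : Real.log (n + 1) / ((n + 1) * n) + (Real.log (n + 1 + 1) + 1) / (n + 1) ≤
        (Real.log (n + 1) + 1) / n := by
      have h3 : (Real.log (n + 1 + 1) + 1) / (n + 1) ≤
          (Real.log (n + 1) + 1 / (n + 1) + 1) / (n + 1) := by gcongr
      have h4 : (Real.log (n + 1) + 1) / n - Real.log (n + 1) / ((n + 1) * n) -
          (Real.log (n + 1) + 1 / (n + 1) + 1) / (n + 1) = 1 / (n * ((n : ℝ) + 1) ^ 2) := by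
        field_simp
        ring
      have h5 : 0 ≤ 1 / (n * ((n : ℝ) + 1) ^ 2) := by positivity
      linarith
    push_cast
    rw [add_sub_cancel_right]
    linarith

lemma sum_primesLE_log_div_mul_le {n : ℕ} (hn : 4 ≤ n) :
    ∑ p ∈ primesLE n, Real.log p / (p * ((p : ℝ) - 1)) ≤ 1.183 := by
  have hsub : primesLE n ⊆ {2, 3} ∪ Finset.Ioc 4 n := by
    intro p hp
    obtain ⟨hpn, hpp⟩ := Nat.mem_primesLE.1 hp
    have h4 : p ≠ 4 := by rintro rfl; revert hpp; decide
    have := hpp.two_le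
    simp only [Finset.mem_union, Finset.mem_insert, Finset.mem_singleton, Finset.mem_Ioc]
    omega
  have hnonneg : ∀ m : ℕ, 0 ≤ Real.log m / (m * ((m : ℝ) - 1)) := by
    intro m
    rcases m with _ | m
    · simp
    · push_cast
      rw [add_sub_cancel_right]
      have : 0 ≤ Real.log ((m : ℝ) + 1) := Real.log_nonneg (by simp)
      positivity
  have h1 : ∑ p ∈ primesLE n, Real.log p / (p * ((p : ℝ) - 1)) ≤
      ∑ p ∈ {2, 3} ∪ Finset.Ioc 4 n, Real.log p / (p * ((p : ℝ) - 1)) :=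
    Finset.sum_le_sum_of_subset_of_nonneg hsub fun m _ _ => hnonneg m
  rw [Finset.sum_union (by
    rw [Finset.disjoint_left]
    intro m hm
    simp only [Finset.mem_insert, Finset.mem_singleton, Finset.mem_Ioc] at hm ⊢
    omega)] at h1
  have h2 := sum_Ioc_log_div_le hn
  have h3 : 0 ≤ (Real.log ((n : ℝ) + 1) + 1) / n := by
    have : 0 ≤ Real.log ((n : ℝ) + 1) := Real.log_nonneg (by simp)
    positivity
  rw [Finset.sum_pair (by norm_num)] at h1
  push_cast at h1
  have := Real.log_two_lt_d9
  have := Real.log_three_lt_d9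
  have := Real.log_five_lt_d9
  norm_num at h1
  linarith

lemma log_factorial_le {n : ℕ} (hn : 5 ≤ n) :
    Real.log (n ! : ℕ) ≤ n * (Real.log ((n : ℝ) - 1) - 0.62) + 1 := by
  induction n, hn using Nat.le_induction with
  | base =>
    have h120 : Real.log (5 ! : ℕ) = 3 * Real.log 2 + Real.log 3 + Real.log 5 := by
      rw [show ((5 ! : ℕ) : ℝ) = 2 ^ 3 * 3 * 5 by norm_num [Nat.factorial],
        Real.log_mul (by norm_num) (by norm_num), Real.log_mul (by norm_num) (by norm_num),
        Real.log_pow]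
      norm_num
    have h4 : Real.log (((5 : ℕ) : ℝ) - 1) = 2 * Real.log 2 := by
      rw [show (((5 : ℕ) : ℝ) - 1) = 2 ^ 2 by norm_num, Real.log_pow]
      norm_num
    rw [h120, h4]
    have := Real.log_two_gt_d9
    have := Real.log_three_lt_d9
    have := Real.log_five_lt_d9
    push_cast
    linarith
  | succ n hn ih =>
    have hn' : (5 : ℝ) ≤ n := by exact_mod_cast hn
    have hprev : Real.log ((n : ℝ) - 1) ≤ Real.log n - 1 / n := by
      have := Real.log_le_sub_one_of_pos (x := ((n : ℝ) - 1) / n)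
        (div_pos (by linarith) (by linarith))
      rw [Real.log_div (by linarith) (by linarith)] at this
      have h2 : ((n : ℝ) - 1) / n - 1 = -(1 / n) := by field_simp; ring
      linarith
    have hnext : Real.log ((n : ℝ) + 1) ≤ Real.log n + 1 / n := by
      have := Real.log_le_sub_one_of_pos (x := ((n : ℝ) + 1) / n) (by positivity)
      rw [Real.log_div (by positivity) (by positivity)] at this
      have h2 : ((n : ℝ) + 1) / n - 1 = 1 / n := by field_simp; ring
      linarith
    have hinv : 1 / (n : ℝ) ≤ 1 / 5 := one_div_le_one_div_of_le (by norm_num) hn'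
    have hmul : (n : ℝ) * Real.log ((n : ℝ) - 1) ≤ n * Real.log n - 1 := by
      calc (n : ℝ) * Real.log ((n : ℝ) - 1) ≤ n * (Real.log n - 1 / n) := by gcongr
        _ = _ := by field_simp
    rw [Nat.factorial_succ]
    push_cast
    rw [Real.log_mul (by positivity) (by positivity), add_sub_cancel_right]
    linarith

lemma div_sub_log_le {B : ℝ} {n : ℕ} (hn : 2 ≤ n) (hB : (n : ℝ) - 1 < B) (hBn : B ≤ n) :
    B / n - Real.log B ≤ 1 - 1 / n - Real.log ((n : ℝ) - 1) := by
  have hn' : (2 : ℝ) ≤ n := by exact_mod_cast hn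
  have hB0 : 0 < B := by linarith
  have := Real.log_le_sub_one_of_pos (x := ((n : ℝ) - 1) / B) (div_pos (by linarith) hB0)
  rw [Real.log_div (by linarith) hB0.ne'] at this
  have h1 : (B - (n - 1)) / n ≤ (B - (n - 1)) / B :=
    div_le_div_of_nonneg_left (by linarith) hB0 hBn
  have h2 : (B - (n - 1)) / B = 1 - (n - 1) / B := by field_simp
  have h3 : (B - (n - 1)) / n = B / n - (1 - 1 / n) := by field_simp
  linarith

lemma sum_primesLE_add_le {n : ℕ} (hn : 2 ≤ n) :
    1 - 1 / (n : ℝ) - Real.log ((n : ℝ) - 1) +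
      ∑ p ∈ primesLE n, Real.log p * (1 / ((p : ℝ) - 1) - 1 / n) ≤ 8 / 5 := by
  have l2 := Real.log_two_lt_d9
  have l2' := Real.log_two_gt_d9
  have l3 := Real.log_three_lt_d9
  have l3' := Real.log_three_gt_d9
  rcases lt_or_ge n 5 with h5 | h5
  · interval_cases n
    · rw [show primesLE 2 = {2} by decide]
      norm_num
      linarith
    · rw [show primesLE 3 = {2, 3} by decide, Finset.sum_pair (by norm_num)]
      norm_num
      linarith
    · rw [show primesLE 4 = {2, 3} by decide, Finset.sum_pair (by norm_num)]
      norm_num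
      linarith
  · have hn' : (0 : ℝ) < n := by positivity
    have h1 := sum_primesLE_log_mul_le (n := n) (by omega)
    have h2 := sum_primesLE_log_div_mul_le (n := n) (by omega)
    have h3 : Real.log (n ! : ℕ) / n ≤ Real.log ((n : ℝ) - 1) - 0.62 + 1 / n := by
      rw [div_le_iff₀ hn']
      have := log_factorial_le h5
      have h4 : (Real.log ((n : ℝ) - 1) - 0.62 + 1 / n) * n =
          n * (Real.log ((n : ℝ) - 1) - 0.62) + 1 := by field_simp
      linarith
    linarith

lemma sum_primeFactors_log_div_le_log_log {b : ℕ} (hb : 2 ≤ b) :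
    ∑ p ∈ b.primeFactors, Real.log p / ((p : ℝ) - 1) ≤ Real.log (Real.log b) + 8 / 5 := by
  have hlog2 : Real.log 2 ≤ Real.log b := Real.log_le_log (by norm_num) (by exact_mod_cast hb)
  have l2 := Real.log_two_gt_d9
  have hB0 : 0 < Real.log b := by linarith
  have hn : 0 < ⌈Real.log b⌉₊ := Nat.ceil_pos.2 hB0
  have hmain := sum_primeFactors_log_div_le (b := b) (by omega) hn
  have hBn := Nat.le_ceil (Real.log b)
  rcases Nat.lt_or_ge ⌈Real.log b⌉₊ 2 with h2 | h2
  · have h1 : ⌈Real.log b⌉₊ = 1 := by omega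
    rw [h1] at hmain hBn
    rw [show primesLE 1 = ∅ by decide] at hmain
    norm_num at hmain hBn
    have := Real.one_sub_inv_le_log_of_pos hB0
    have hinv : (Real.log b)⁻¹ ≤ 3 / 2 := by
      rw [inv_le_comm₀ hB0 (by norm_num)]
      linarith
    linarith
  · have hlt := Nat.ceil_lt_add_one hB0.le
    have := div_sub_log_le h2 (by linarith) hBn
    have := sum_primesLE_add_le h2
    linarith

lemma prod_primeFactors_pow_factorization_factorial_le {b : ℕ} (hb : 2 ≤ b) (N : ℕ) :
    ((∏ p ∈ b.primeFactors, p ^ (N !).factorization p : ℕ) : ℝ) ≤ (5 * Real.log b) ^ N := by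
  have hB0 : 0 < Real.log b := Real.log_pos (by exact_mod_cast hb)
  have hexp : Real.exp (8 / 5) ≤ 5 := by
    have h : Real.exp (8 / 5) ^ 5 ≤ 5 ^ 5 := by
      rw [← Real.exp_nat_mul, show ((5 : ℕ) : ℝ) * (8 / 5) = (8 : ℕ) * 1 by norm_num,
        Real.exp_nat_mul]
      calc Real.exp 1 ^ 8 ≤ 2.7182818286 ^ 8 := by
            gcongr
            exact Real.exp_one_lt_d9.le
        _ ≤ 5 ^ 5 := by norm_num
    exact (pow_le_pow_iff_left₀ (Real.exp_pos _).le (by norm_num) (by norm_num)).1 h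
  have hterm : ∀ p ∈ b.primeFactors, ((p : ℝ) ^ (N !).factorization p) ≤
      Real.exp (Real.log p / ((p : ℝ) - 1) * N) := by
    intro p hp
    have hpp := Nat.prime_of_mem_primeFactors hp
    have h2 : (2 : ℝ) ≤ p := by exact_mod_cast hpp.two_le
    have hleg : ((p : ℝ) - 1) * (N !).factorization p ≤ N := by
      have : Fact p.Prime := ⟨hpp⟩
      have h := sub_one_mul_padicValNat_factorial (p := p) N
      rw [← Nat.factorization_def _ hpp] at h
      have h' : (p - 1) * (N !).factorization p ≤ N := h.trans_le (Nat.sub_le _ _)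
      rw [← Nat.cast_one, ← Nat.cast_sub hpp.one_lt.le]
      exact_mod_cast h'
    have hlog : 0 ≤ Real.log p := Real.log_nonneg (by linarith)
    rw [← Real.exp_log (pow_pos (by linarith : (0 : ℝ) < p) _), Real.exp_le_exp, Real.log_pow,
      div_mul_eq_mul_div, le_div_iff₀ (by linarith)]
    nlinarith
  push_cast
  calc ∏ p ∈ b.primeFactors, (p : ℝ) ^ (N !).factorization p
      ≤ ∏ p ∈ b.primeFactors, Real.exp (Real.log p / ((p : ℝ) - 1) * N) :=
        Finset.prod_le_prod (fun _ _ => by positivity) hterm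
    _ = Real.exp (∑ p ∈ b.primeFactors, Real.log p / ((p : ℝ) - 1)) ^ N := by
        rw [← Real.exp_sum, ← Finset.sum_mul, mul_comm, Real.exp_nat_mul]
    _ ≤ Real.exp (Real.log (Real.log b) + 8 / 5) ^ N := by
        gcongr
        exact sum_primeFactors_log_div_le_log_log hb
    _ ≤ (5 * Real.log b) ^ N := by
        rw [Real.exp_add, Real.exp_log hB0, mul_comm]
        gcongr

lemma L_dvd_L_mod (a b n : ℕ) : L a b n ∣ L (a % b) b (n + a / b) := by
  refine Finset.lcm_dvd fun k hk => ?_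
  have hk' := mem_range.1 hk
  have h : a + k * b = a % b + (k + a / b) * b := by
    conv_lhs => rw [← Nat.mod_add_div a b]
    ring
  rw [h]
  exact Finset.dvd_lcm (f := fun k => a % b + k * b) (mem_range.2 (by omega))

lemma prod_add_mul_le {a b : ℕ} (hab : a ≤ b) (N : ℕ) :
    ∏ k ∈ range (N + 1), (a + k * b) ≤ b ^ (N + 1) * (N + 1)! := by
  calc ∏ k ∈ range (N + 1), (a + k * b) ≤ ∏ k ∈ range (N + 1), (b * (k + 1)) :=
        Finset.prod_le_prod' fun k _ => by nlinarith
    _ = b ^ (N + 1) * (N + 1)! := by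
        rw [Finset.prod_mul_distrib, Finset.prod_range_add_one_eq_factorial]
        simp

lemma succ_mul_pred_le_two_pow {N : ℕ} (hN : 3 ≤ N) : (N + 1) * (N - 1) ≤ 2 ^ N := by
  obtain ⟨m, rfl⟩ := Nat.exists_eq_add_of_le' hN
  induction m with
  | zero => norm_num
  | succ m ih =>
    have := ih (by omega)
    rw [show m + 1 + 3 = m + 3 + 1 by ring, pow_succ]
    simp only [Nat.add_sub_cancel, show m + 3 - 1 = m + 2 by omega] at this ⊢
    nlinarith

lemma L_le_of_lt {r b N : ℕ} (hr : 0 < r) (hrb : r < b) (hb : 2 ≤ b) (hcop : r.Coprime b)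
    (hN : b + 1 ≤ N) : (L r b N : ℝ) ≤ (40 * b * Real.log b) ^ N := by
  set Q := ∏ p ∈ b.primeFactors, p ^ (N !).factorization p
  have hQpos : 0 < Q :=
    Finset.prod_pos fun p hp => pow_pos (Nat.prime_of_mem_primeFactors hp).pos _
  have hdvd := L_mul_factorial_dvd (N := N) hr (by omega) hcop (by omega)
  have hle : L r b N * N ! ≤ b ^ (N + 1) * (N + 1)! * 4 ^ N * Q := by
    refine (Nat.le_of_dvd ?_ hdvd).trans ?_
    · exact mul_pos (mul_pos (Finset.prod_pos fun k _ => by positivity) (lcmUpto_pos N)) hQpos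
    · gcongr
      · exact prod_add_mul_le hrb.le N
      · exact lcmUpto_le_four_pow N
  have hle' : L r b N ≤ b ^ (N + 1) * (N + 1) * 4 ^ N * Q := by
    refine Nat.le_of_mul_le_mul_right (hle.trans_eq ?_) (factorial_pos N)
    rw [Nat.factorial_succ]
    ring
  have hsmall : b * (N + 1) ≤ 2 ^ N := by
    refine le_trans ?_ (succ_mul_pred_le_two_pow (by omega : 3 ≤ N))
    rw [mul_comm]
    exact Nat.mul_le_mul_left _ (by omega)
  have hnat : L r b N ≤ (8 * b) ^ N * Q := by
    refine hle'.trans (Nat.mul_le_mul_right _ ?_)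
    calc b ^ (N + 1) * (N + 1) * 4 ^ N = b * (N + 1) * (4 ^ N * b ^ N) := by ring
      _ ≤ 2 ^ N * (4 ^ N * b ^ N) := Nat.mul_le_mul_right _ hsmall
      _ = (8 * b) ^ N := by rw [← mul_pow, ← mul_pow]; congr 1; ring
  calc (L r b N : ℝ) ≤ (8 * b) ^ N * (Q : ℝ) := by exact_mod_cast hnat
    _ ≤ (8 * b) ^ N * (5 * Real.log b) ^ N := by
        gcongr
        exact prod_primeFactors_pow_factorization_factorial_le hb N
    _ = (40 * b * Real.log b) ^ N := by rw [← mul_pow]; congr 1; ring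

end

theorem lcm_ap_upper_bound (a b : ℕ) (ha : 0 < a) (hb : 2 ≤ b)
    (hab : Nat.Coprime a b) :
    ∀ n : ℕ, b + 1 ≤ n →
      (L a b n : ℝ) ≤ (41.30142 * b * Real.log b) ^ (n + a / b) := by
  intro n hn
  have hcop : (a % b).Coprime b := by
    rw [Nat.Coprime, ← Nat.gcd_rec]
    exact hab.symm
  have hr : 0 < a % b := by
    refine Nat.pos_of_ne_zero fun h => ?_
    rw [h, Nat.coprime_zero_left] at hcop
    omega
  have hlog : 0 ≤ Real.log b := Real.log_natCast_nonneg b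
  calc (L a b n : ℝ) ≤ L (a % b) b (n + a / b) := by
        exact_mod_cast Nat.le_of_dvd (Nat.pos_of_ne_zero (L_ne_zero hr _ _)) (L_dvd_L_mod a b n)
    _ ≤ (40 * b * Real.log b) ^ (n + a / b) :=
        L_le_of_lt hr (Nat.mod_lt _ (by omega)) hb hcop (Nat.le_add_right_of_le hn)
    _ ≤ _ := by
        gcongr
        norm_num
end

section
/- For every integer r ≥ 2, we have log(r+1) ≤ r · M(r) ≤ log r + log log r + log 41.30142. -/
open Finset in
/-- `M n = (1/φ(n)) · Σ_{1 ≤ ℓ ≤ n, gcd(ℓ,n)=1} 1/ℓ`. -/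
noncomputable def M (n : ℕ) : ℝ :=
  (1 / (Nat.totient n : ℝ)) *
    ∑ l ∈ (Finset.Icc 1 n).filter (fun l => Nat.gcd l n = 1), (1 : ℝ) / l

open Finset in
/-- The sum of `1 / l` over the `1 ≤ l ≤ n` that no element of `P` divides. -/
noncomputable def siftedHarmonic (P : Finset ℕ) (n : ℕ) : ℝ :=
  ∑ l ∈ (Icc 1 n).filter (fun l => ∀ p ∈ P, ¬ p ∣ l), (1 : ℝ) / l

theorem siftedHarmonic_empty (n : ℕ) : siftedHarmonic ∅ n = harmonic n := by
  simp [siftedHarmonic, harmonic_eq_sum_Icc]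

theorem siftedHarmonic_mono (P : Finset ℕ) {m n : ℕ} (h : m ≤ n) :
    siftedHarmonic P m ≤ siftedHarmonic P n := by
  refine Finset.sum_le_sum_of_subset_of_nonneg
    (Finset.filter_subset_filter _ (Finset.Icc_subset_Icc_right h)) fun _ _ _ => by positivity

theorem siftedHarmonic_insert {P : Finset ℕ} {q : ℕ} (hP : ∀ p ∈ P, p.Prime) (hq : q.Prime)
    (hqP : q ∉ P) (n : ℕ) :
    siftedHarmonic (insert q P) n = siftedHarmonic P n - 1 / q * siftedHarmonic P (n / q) := by
  rw [eq_sub_iff_add_eq, siftedHarmonic, siftedHarmonic, siftedHarmonic,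
    ← Finset.sum_filter_add_sum_filter_not
      ((Finset.Icc 1 n).filter (fun l => ∀ p ∈ P, ¬ p ∣ l)) (fun l => ¬ q ∣ l)]
  congr 1
  · refine Finset.sum_congr ?_ fun _ _ => rfl
    ext l
    simp only [Finset.mem_filter, Finset.mem_insert, forall_eq_or_imp]
    tauto
  · rw [Finset.mul_sum]
    refine Finset.sum_bij (fun m _ => q * m) ?_ ?_ ?_ ?_
    · intro m hm
      simp only [Finset.mem_filter, Finset.mem_Icc, not_not] at hm ⊢
      refine ⟨⟨⟨Nat.mul_pos hq.pos hm.1.1, ?_⟩, fun p hp hpm => ?_⟩, dvd_mul_right q m⟩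
      · calc q * m ≤ q * (n / q) := Nat.mul_le_mul_left q hm.1.2
          _ ≤ n := Nat.mul_div_le n q
      · rcases (hP p hp).dvd_mul.1 hpm with h | h
        · exact hqP ((Nat.prime_dvd_prime_iff_eq (hP p hp) hq).1 h ▸ hp)
        · exact hm.2 p hp h
    · intro a _ b _ h
      exact Nat.eq_of_mul_eq_mul_left hq.pos h
    · intro l hl
      simp only [Finset.mem_filter, Finset.mem_Icc, not_not] at hl
      obtain ⟨⟨⟨h1, h2⟩, h3⟩, m, rfl⟩ := hl
      refine ⟨m, ?_, rfl⟩
      simp only [Finset.mem_filter, Finset.mem_Icc]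
      exact ⟨⟨Nat.pos_of_mul_pos_left h1, (Nat.le_div_iff_mul_le hq.pos).2 (by rwa [mul_comm])⟩,
        fun p hp hpm => h3 p hp (dvd_mul_of_dvd_right hpm q)⟩
    · intro m _
      push_cast
      rw [one_div_mul_one_div]

theorem prod_one_sub_inv_mul_harmonic_le {P : Finset ℕ} (hP : ∀ p ∈ P, p.Prime) (n : ℕ) :
    (∏ p ∈ P, (1 - (p : ℝ)⁻¹)) * harmonic n ≤ siftedHarmonic P n := by
  induction P using Finset.induction_on with
  | empty => simp [siftedHarmonic_empty]
  | insert q P hqP ih =>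
    have hq := hP q (Finset.mem_insert_self q P)
    have hP' : ∀ p ∈ P, p.Prime := fun p hp => hP p (Finset.mem_insert_of_mem hp)
    rw [Finset.prod_insert hqP, siftedHarmonic_insert hP' hq hqP]
    have hq1 : (q : ℝ)⁻¹ ≤ 1 := inv_le_one_of_one_le₀ (mod_cast hq.one_le)
    have hmono := mul_le_mul_of_nonneg_left (siftedHarmonic_mono P (Nat.div_le_self n q))
      (by positivity : (0 : ℝ) ≤ (q : ℝ)⁻¹)
    have := mul_le_mul_of_nonneg_left (ih hP') (sub_nonneg.2 hq1)
    rw [one_div]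
    linarith

theorem abs_harmonic_sub_le {n : ℕ} (hn : n ≠ 0) :
    |(harmonic n : ℝ) - (Real.log n + Real.eulerMascheroniConstant) - 1 / (2 * n)|
      ≤ 1 / (2 * n) := by
  have hn0 : (0 : ℝ) < n := by positivity
  have h1 := Real.eulerMascheroniSeq_lt_eulerMascheroniConstant n
  have h2 := Real.eulerMascheroniConstant_lt_eulerMascheroniSeq' n
  rw [Real.eulerMascheroniSeq] at h1
  rw [Real.eulerMascheroniSeq', if_neg hn] at h2
  have h3 : Real.log (n + 1) ≤ Real.log n + 1 / n := by
    have h := Real.log_le_sub_one_of_pos (x := (n + 1) / n) (by positivity)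
    rw [Real.log_div (by positivity) (by positivity)] at h
    have : ((n : ℝ) + 1) / n - 1 = 1 / n := by field_simp; ring
    linarith
  have h4 : (1 : ℝ) / n = 1 / (2 * n) + 1 / (2 * n) := by field_simp; norm_num
  rw [abs_le]
  constructor <;> linarith

theorem abs_siftedHarmonic_sub_le {P : Finset ℕ} (hP : ∀ p ∈ P, p.Prime) {n : ℕ} (hn : n ≠ 0)
    (hdvd : ∏ p ∈ P, p ∣ n) :
    |siftedHarmonic P n - (∏ p ∈ P, (1 - (p : ℝ)⁻¹)) *
        (Real.log n + Real.eulerMascheroniConstant + ∑ p ∈ P, Real.log p / (p - 1))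
        - 0 ^ P.card / (2 * n)| ≤ 2 ^ P.card / (2 * n) := by
  induction P using Finset.induction_on generalizing n with
  | empty => simpa [siftedHarmonic_empty] using abs_harmonic_sub_le hn
  | insert q P hqP ih =>
    have hq := hP q (Finset.mem_insert_self q P)
    have hP' : ∀ p ∈ P, p.Prime := fun p hp => hP p (Finset.mem_insert_of_mem hp)
    rw [Finset.prod_insert hqP] at hdvd
    obtain ⟨m, rfl⟩ := (dvd_mul_right q _).trans hdvd
    have hdvd' := Nat.dvd_of_mul_dvd_mul_left hq.pos hdvd
    have hm : m ≠ 0 := right_ne_zero_of_mul hn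
    have e1 := ih hP' hn (hdvd'.mul_left q)
    have e2 := ih hP' hm hdvd'
    rw [siftedHarmonic_insert hP' hq hqP, Nat.mul_div_cancel_left _ hq.pos,
      Finset.prod_insert hqP, Finset.sum_insert hqP, Finset.card_insert_of_notMem hqP]
    have hq0 : (0 : ℝ) < q := mod_cast hq.pos
    have hm0 : (0 : ℝ) < m := by positivity
    have hq1 : (q : ℝ) - 1 ≠ 0 := sub_ne_zero.2 (mod_cast hq.one_lt.ne')
    push_cast at e1 ⊢
    rw [Real.log_mul hq0.ne' hm0.ne'] at e1 ⊢
    set F := siftedHarmonic P (q * m)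
    set G := siftedHarmonic P m
    set Φ := ∏ p ∈ P, (1 - (p : ℝ)⁻¹)
    set S := ∑ p ∈ P, Real.log p / ((p : ℝ) - 1)
    set γ := Real.eulerMascheroniConstant
    set z : ℝ := 0 ^ P.card
    set w : ℝ := 2 ^ P.card with hw
    set A := F - Φ * (Real.log q + Real.log m + γ + S) - z / (2 * (q * m)) with hA
    set B := G - Φ * (Real.log m + γ + S) - z / (2 * m) with hB
    have key : F - 1 / q * G - (1 - (q : ℝ)⁻¹) * Φ *
        (Real.log q + Real.log m + γ + (Real.log q / (q - 1) + S))
        - 0 ^ (P.card + 1) / (2 * (q * m)) = A - 1 / q * B := by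
      rw [hA, hB, pow_succ]
      field_simp
      ring
    rw [key]
    have hB' : |1 / q * B| ≤ 1 / q * (w / (2 * m)) := by
      rw [abs_mul, abs_of_pos (by positivity : (0 : ℝ) < 1 / q)]
      gcongr
    calc |A - 1 / q * B| ≤ |A| + |1 / q * B| := abs_sub _ _
      _ ≤ w / (2 * (q * m)) + 1 / q * (w / (2 * m)) := add_le_add e1 hB'
      _ = 2 ^ (P.card + 1) / (2 * (q * m)) := by rw [pow_succ, ← hw]; field_simp; ring

theorem two_pow_card_le_two_mul_prod {P : Finset ℕ} (hP : ∀ p ∈ P, p.Prime) :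
    2 ^ P.card ≤ 2 * ∏ p ∈ P, (p - 1) := by
  have hodd : ∀ Q : Finset ℕ, (∀ p ∈ Q, p.Prime) → 2 ∉ Q → 2 ^ Q.card ≤ ∏ p ∈ Q, (p - 1) := by
    intro Q hQ h2
    rw [← Finset.prod_const]
    refine Finset.prod_le_prod' fun p hp => ?_
    have := (hQ p hp).two_le
    have : p ≠ 2 := fun h => h2 (h ▸ hp)
    omega
  by_cases h2 : 2 ∈ P
  · rw [← Finset.mul_prod_erase P _ h2, ← Finset.card_erase_add_one h2, pow_succ, mul_comm]
    have := hodd (P.erase 2) (fun p hp => hP p (Finset.mem_of_mem_erase hp))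
      (Finset.notMem_erase 2 P)
    omega
  · have := hodd P hP h2
    omega

theorem two_pow_card_primeFactors_le {r : ℕ} (hr : r ≠ 0) :
    2 ^ r.primeFactors.card ≤ 2 * r.totient := by
  refine (two_pow_card_le_two_mul_prod fun p hp => Nat.prime_of_mem_primeFactors hp).trans ?_
  rw [Nat.totient_eq_div_primeFactors_mul]
  refine Nat.mul_le_mul_left 2 (Nat.le_mul_of_pos_left _ ?_)
  exact Nat.div_pos (Nat.le_of_dvd (Nat.pos_of_ne_zero hr) (Nat.prod_primeFactors_dvd r))
    (Finset.prod_pos fun p hp => (Nat.prime_of_mem_primeFactors hp).pos)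

theorem sum_log_div_mul_sub_one_le {P : Finset ℕ} (hP : ∀ p ∈ P, p.Prime) :
    ∑ p ∈ P, Real.log p / (p * (p - 1)) ≤ 1.002 := by
  have hstep : ∀ m : ℕ, 2 ≤ m → Real.log m / (m * (m - 1)) ≤
      (Real.log m + 1) / (m - 1) - (Real.log (m + 1 : ℕ) + 1) / ((m + 1 : ℕ) - 1) := by
    intro m hm
    have hm' : (2 : ℝ) ≤ m := mod_cast hm
    have h1 : Real.log (m + 1) ≤ Real.log m + 1 / m := by
      have h := Real.log_le_sub_one_of_pos (x := ((m : ℝ) + 1) / m) (by positivity)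
      rw [Real.log_div (by positivity) (by positivity)] at h
      have : ((m : ℝ) + 1) / m - 1 = 1 / m := by field_simp; ring
      linarith
    have h2 : (Real.log (m + 1 : ℕ) + 1) / ((m + 1 : ℕ) - 1) ≤ (Real.log m + 1 / m + 1) / m := by
      push_cast
      rw [add_sub_cancel_right]
      gcongr
    have hm1 : (0 : ℝ) < m - 1 := by linarith
    have h3 : (Real.log m + 1) / (m - 1) - (Real.log m + 1 / m + 1) / m
        - Real.log m / (m * (m - 1)) = 1 / (m ^ 2 * (m - 1)) := by
      field_simp
      ring
    have h4 : (0 : ℝ) < 1 / (m ^ 2 * (m - 1)) := by positivity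
    linarith
  have hlog : ∀ p a b : ℕ, 0 < p → 0 < a → p ^ a ≤ 2 ^ b → Real.log p ≤ b / a * Real.log 2 := by
    intro p a b hp ha h
    have := Real.log_le_log (by positivity) (by exact_mod_cast h : (p : ℝ) ^ a ≤ 2 ^ b)
    rw [Real.log_pow, Real.log_pow] at this
    have ha' : (0 : ℝ) < a := mod_cast ha
    rw [div_mul_eq_mul_div, le_div_iff₀ ha']
    linarith
  have h2 := Real.log_two_lt_d9
  have h3 := hlog 3 5 8 (by norm_num) (by norm_num) (by norm_num)
  have h5 := hlog 5 3 7 (by norm_num) (by norm_num) (by norm_num)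
  have h7 := hlog 7 6 17 (by norm_num) (by norm_num) (by norm_num)
  have h11 := hlog 11 2 7 (by norm_num) (by norm_num) (by norm_num)
  push_cast at h3 h5 h7 h11
  have hbound : ∀ N : ℕ, 11 ≤ N →
      ∑ p ∈ (Finset.range N).filter Nat.Prime, Real.log p / (p * (p - 1))
        ≤ 1.002 - (Real.log N + 1) / (N - 1) := by
    intro N hN
    induction N, hN using Nat.le_induction with
    | base =>
      have : (Finset.range 11).filter Nat.Prime = {2, 3, 5, 7} := by decide
      rw [this]
      norm_num
      linarith
    | succ N hN ih =>
      have hs := hstep N (by omega)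
      have hnonneg : 0 ≤ Real.log N / ((N : ℝ) * (N - 1)) := by
        have : (1 : ℝ) ≤ N := mod_cast (by omega : 1 ≤ N)
        exact div_nonneg (Real.log_nonneg this) (mul_nonneg (by linarith) (by linarith))
      rw [Finset.range_add_one, Finset.filter_insert]
      split_ifs
      · rw [Finset.sum_insert (by simp)]
        linarith
      · linarith
  obtain ⟨N, hN⟩ := P.exists_nat_subset_range
  have hsub : P ⊆ (Finset.range (N + 11)).filter Nat.Prime := fun p hp =>
    Finset.mem_filter.2 ⟨Finset.mem_range.2 (by have := Finset.mem_range.1 (hN hp); omega), hP p hp⟩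
  have hN1 : (1 : ℝ) ≤ ((N + 11 : ℕ) : ℝ) := mod_cast (by omega)
  have htail : 0 ≤ (Real.log (N + 11 : ℕ) + 1) / (((N + 11 : ℕ) : ℝ) - 1) :=
    div_nonneg (by linarith [Real.log_nonneg hN1]) (by linarith)
  refine (Finset.sum_le_sum_of_subset_of_nonneg hsub fun p hp _ => ?_).trans
    ((hbound (N + 11) (by omega)).trans (by linarith))
  have : (1 : ℝ) ≤ p := mod_cast (Finset.mem_filter.1 hp).2.one_le
  exact div_nonneg (Real.log_nonneg this) (mul_nonneg (by linarith) (by linarith))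

theorem sum_primes_div_mul_log_le_log_factorial {P : Finset ℕ} (hP : ∀ p ∈ P, p.Prime) (n : ℕ) :
    ∑ p ∈ P, ((n / p : ℕ) : ℝ) * Real.log p ≤ Real.log n.factorial := by
  have hdvd : ∏ p ∈ P, p ^ (n / p) ∣ n.factorial := by
    refine Finset.prod_dvd_of_isRelPrime (fun p hp q hq hpq => ?_) fun p hp => ?_
    · exact Nat.coprime_iff_isRelPrime.1
        (Nat.Coprime.pow _ _ ((Nat.coprime_primes (hP p hp) (hP q hq)).2 hpq))
    · rw [(hP p hp).pow_dvd_factorial_iff (b := Nat.log p n + 2) (by omega)]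
      simpa using Finset.single_le_sum (f := fun i => n / p ^ i) (fun _ _ => Nat.zero_le _)
        (Finset.mem_Ico.2 ⟨le_rfl, by omega⟩ : 1 ∈ Finset.Ico 1 (Nat.log p n + 2))
  have hpos : 0 < ∏ p ∈ P, p ^ (n / p) := Finset.prod_pos fun p hp => pow_pos (hP p hp).pos _
  have hle := Nat.le_of_dvd n.factorial_pos hdvd
  have h := Real.log_le_log (mod_cast hpos) (Nat.cast_le (α := ℝ).2 hle)
  push_cast at h
  rw [Real.log_prod (fun p hp => pow_ne_zero _ (mod_cast (hP p hp).ne_zero))] at h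
  simpa only [Real.log_pow] using h

theorem sum_log_div_sub_one_le {r n : ℕ} (hr : r ≠ 0) (hn : n ≠ 0) :
    ∑ p ∈ r.primeFactors, Real.log p / (p - 1)
      ≤ Real.log n.factorial / n + Real.log r / n + 1.002 := by
  have hP : ∀ p ∈ r.primeFactors, p.Prime := fun p hp => Nat.prime_of_mem_primeFactors hp
  have hn0 : (0 : ℝ) < n := by positivity
  have h1 := sum_primes_div_mul_log_le_log_factorial hP n
  have h2 := sum_log_div_mul_sub_one_le hP
  have h3 : ∑ p ∈ r.primeFactors, Real.log p ≤ Real.log r := by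
    rw [← Real.log_prod (fun p hp => mod_cast (hP p hp).ne_zero)]
    refine Real.log_le_log (Finset.prod_pos fun p hp => mod_cast (hP p hp).pos) ?_
    have h := Nat.le_of_dvd (Nat.pos_of_ne_zero hr) (Nat.prod_primeFactors_dvd r)
    rw [← Nat.cast_prod]
    exact Nat.cast_le.2 h
  have h4 : ∑ p ∈ r.primeFactors, Real.log p / ((p : ℝ) - 1) ≤
      ∑ p ∈ r.primeFactors, (((n / p : ℕ) : ℝ) * Real.log p / n + Real.log p / n
        + Real.log p / (p * (p - 1))) := by
    refine Finset.sum_le_sum fun p hp => ?_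
    have hp2 : (2 : ℝ) ≤ p := mod_cast (hP p hp).two_le
    have hp1 : (0 : ℝ) < p - 1 := by linarith
    have hlog : 0 ≤ Real.log p := Real.log_nonneg (by linarith)
    have hfloor : (n : ℝ) ≤ p * ((n / p : ℕ) + 1) :=
      mod_cast (Nat.lt_mul_div_succ n (hP p hp).pos).le
    have hsplit : Real.log p / ((p : ℝ) - 1) =
        Real.log p * (1 / p) + Real.log p / (p * (p - 1)) := by
      field_simp
      ring
    have hinv : 1 / (p : ℝ) ≤ ((n / p : ℕ) + 1) / n := by
      rw [div_le_div_iff₀ (by linarith) hn0]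
      linarith
    have := mul_le_mul_of_nonneg_left hinv hlog
    have hring : Real.log p * ((((n / p : ℕ) : ℝ) + 1) / n)
        = ((n / p : ℕ) : ℝ) * Real.log p / n + Real.log p / n := by ring
    linarith
  rw [Finset.sum_add_distrib, Finset.sum_add_distrib, ← Finset.sum_div, ← Finset.sum_div] at h4
  have h5 := div_le_div_of_nonneg_right h1 hn0.le
  have h6 := div_le_div_of_nonneg_right h3 hn0.le
  linarith

theorem factorial_le_half_pow (n : ℕ) : (n.factorial : ℝ) ≤ (((n : ℝ) + 1) / 2) ^ n := by
  induction n with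
  | zero => simp
  | succ n ih =>
    have hb := one_add_mul_le_pow (a := 1 / ((n : ℝ) + 1))
      (by linarith [(by positivity : (0 : ℝ) ≤ 1 / ((n : ℝ) + 1))]) (n + 1)
    have h2 : 1 + ((n + 1 : ℕ) : ℝ) * (1 / ((n : ℝ) + 1)) = 2 := by
      push_cast
      field_simp
      norm_num
    rw [h2] at hb
    rw [Nat.factorial_succ]
    push_cast
    calc ((n : ℝ) + 1) * n.factorial ≤ (n + 1) * (((n : ℝ) + 1) / 2) ^ n := by gcongr
      _ = (((n : ℝ) + 1) / 2) ^ (n + 1) * 2 := by ring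
      _ ≤ (((n : ℝ) + 1) / 2) ^ (n + 1) * (1 + 1 / ((n : ℝ) + 1)) ^ (n + 1) := by gcongr
      _ = (((n : ℝ) + 1 + 1) / 2) ^ (n + 1) := by
        rw [← mul_pow]
        congr 1
        field_simp

theorem log_factorial_div_le {n : ℕ} (hn : n ≠ 0) :
    Real.log n.factorial / n ≤ Real.log (((n : ℝ) + 1) / 2) := by
  have hn0 : (0 : ℝ) < n := by positivity
  rw [div_le_iff₀ hn0, mul_comm, ← Real.log_pow]
  exact Real.log_le_log (by positivity) (factorial_le_half_pow n)

theorem sum_log_div_sub_one_le_log_log {r : ℕ} (hr : 3 ≤ r) :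
    ∑ p ∈ r.primeFactors, Real.log p / (p - 1) ≤ Real.log (Real.log r) + 2.002 := by
  have hL1 : 1 ≤ Real.log r := by
    rw [Real.le_log_iff_exp_le (by positivity)]
    have : (3 : ℝ) ≤ r := mod_cast hr
    linarith [Real.exp_one_lt_d9]
  set L := Real.log r with hL
  rcases le_total L 2 with h2 | h2
  · have h := sum_log_div_sub_one_le (r := r) (n := 2) (by omega) two_ne_zero
    have hlogL : 1 - L⁻¹ ≤ Real.log L := Real.one_sub_inv_le_log_of_pos (by linarith)
    have hL' : L / 2 + L⁻¹ ≤ 3 / 2 := by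
      have : L / 2 + L⁻¹ - 3 / 2 = (L - 1) * (L - 2) / (2 * L) := by field_simp; ring
      have : (L - 1) * (L - 2) / (2 * L) ≤ 0 :=
        div_nonpos_of_nonpos_of_nonneg
          (mul_nonpos_of_nonneg_of_nonpos (by linarith) (by linarith)) (by linarith)
      linarith
    norm_num at h
    linarith [Real.log_two_lt_d9]
  · have hc : L ≤ ⌈L⌉₊ := Nat.le_ceil L
    have hc' : (⌈L⌉₊ : ℝ) < L + 1 := Nat.ceil_lt_add_one (by linarith)
    have hn : ⌈L⌉₊ ≠ 0 := (Nat.ceil_pos.2 (by linarith)).ne'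
    have h := sum_log_div_sub_one_le (r := r) (by omega) hn
    have h1 := log_factorial_div_le hn
    have h3 : Real.log (((⌈L⌉₊ : ℝ) + 1) / 2) ≤ Real.log L :=
      Real.log_le_log (by positivity) (by linarith)
    have h4 : L / ⌈L⌉₊ ≤ 1 := div_le_one_of_le₀ hc (by positivity)
    linarith

theorem log_const_ge : (3.69 : ℝ) ≤ Real.log 41.30142 := by
  have h := Real.log_le_log (x := 2 ^ 16) (y := (41.30142 : ℝ) ^ 3) (by norm_num) (by norm_num)
  rw [Real.log_pow, Real.log_pow] at h
  have := Real.log_two_gt_d9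
  norm_num at h ⊢
  linarith

theorem filter_gcd_eq_one (r : ℕ) (hr : r ≠ 0) :
    (Finset.Icc 1 r).filter (fun l => Nat.gcd l r = 1)
      = (Finset.Icc 1 r).filter (fun l => ∀ p ∈ r.primeFactors, ¬ p ∣ l) := by
  refine Finset.filter_congr fun l _ => ⟨fun h p hp hpl => ?_, fun h => ?_⟩
  · have hp' := Nat.prime_of_mem_primeFactors hp
    exact hp'.not_dvd_one (h ▸ Nat.dvd_gcd hpl (Nat.dvd_of_mem_primeFactors hp))
  · exact Nat.coprime_of_dvd fun p hp hpl hpr => h p (Nat.mem_primeFactors.2 ⟨hp, hpr, hr⟩) hpl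

theorem totient_eq_mul_prod_real (r : ℕ) :
    (r.totient : ℝ) = r * ∏ p ∈ r.primeFactors, (1 - (p : ℝ)⁻¹) := by
  have h := congrArg (Rat.cast : ℚ → ℝ) (Nat.totient_eq_mul_prod_factors r)
  push_cast at h
  exact h

theorem M_bounds (r : ℕ) (hr : 2 ≤ r) :
    Real.log (r + 1) ≤ r * M r ∧
      r * M r ≤ Real.log r + Real.log (Real.log r) + Real.log 41.30142 := by
  have hr0 : r ≠ 0 := by omega
  have hrpos : (0 : ℝ) < r := by positivity
  have hP : ∀ p ∈ r.primeFactors, p.Prime := fun p hp => Nat.prime_of_mem_primeFactors hp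
  have htot : (0 : ℝ) < r.totient := mod_cast Nat.totient_pos.2 (by omega)
  have hφ := totient_eq_mul_prod_real r
  set Φ := ∏ p ∈ r.primeFactors, (1 - (p : ℝ)⁻¹) with hΦ
  have hΦpos : 0 < Φ := pos_of_mul_pos_right (hφ ▸ htot) hrpos.le
  have hM : r * M r = siftedHarmonic r.primeFactors r / Φ := by
    rw [M, filter_gcd_eq_one r hr0, hφ, siftedHarmonic]
    field_simp
  rw [hM]
  constructor
  · rw [le_div_iff₀ hΦpos, mul_comm]
    refine le_trans ?_ (prod_one_sub_inv_mul_harmonic_le hP r)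
    exact mul_le_mul_of_nonneg_left (by exact_mod_cast log_add_one_le_harmonic r) hΦpos.le
  · rcases hr.eq_or_lt with rfl | hr3
    · have hs : siftedHarmonic (Nat.primeFactors 2) 2 = 1 := by
        rw [siftedHarmonic, ← filter_gcd_eq_one 2 two_ne_zero]
        have : (Finset.Icc 1 2).filter (fun l => Nat.gcd l 2 = 1) = {1} := by decide
        rw [this]
        simp
      have hΦ2 : Φ = 1 / 2 := by
        simp [hΦ, Nat.prime_two.primeFactors]
        norm_num
      have hll : 1 - (Real.log 2)⁻¹ ≤ Real.log (Real.log 2) :=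
        Real.one_sub_inv_le_log_of_pos (Real.log_pos one_lt_two)
      have hinv : (Real.log 2)⁻¹ ≤ 3 / 2 := by
        rw [inv_le_comm₀ (Real.log_pos one_lt_two) (by norm_num)]
        linarith [Real.log_two_gt_d9]
      rw [hs, hΦ2]
      push_cast
      linarith [log_const_ge, Real.log_two_gt_d9]
    · have hcard : r.primeFactors.card ≠ 0 :=
        (Finset.card_pos.2 (Nat.nonempty_primeFactors.2 (by omega))).ne'
      have h := (abs_le.1 (abs_siftedHarmonic_sub_le hP hr0 (Nat.prod_primeFactors_dvd r))).2
      rw [zero_pow hcard, zero_div, sub_zero, ← hΦ] at h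
      have herr : (2 : ℝ) ^ r.primeFactors.card / (2 * r) ≤ Φ := by
        rw [div_le_iff₀ (by positivity)]
        have : (2 : ℝ) ^ r.primeFactors.card ≤ 2 * r.totient :=
          mod_cast two_pow_card_primeFactors_le hr0
        rw [hφ] at this
        linarith
      have hsum := sum_log_div_sub_one_le_log_log hr3
      rw [div_le_iff₀ hΦpos]
      have hfin : Real.log r + Real.eulerMascheroniConstant
          + ∑ p ∈ r.primeFactors, Real.log p / ((p : ℝ) - 1) + 1
          ≤ Real.log r + Real.log (Real.log r) + Real.log 41.30142 := by
        linarith [log_const_ge, Real.eulerMascheroniConstant_lt_two_thirds]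
      have := mul_le_mul_of_nonneg_right hfin hΦpos.le
      linarith
end

section
/- Let ℓ be a positive integer and k a prime number with k > ℓ. Then for every real number x ≥ k(k+1), we have θ(x; k, ℓ) ≤ x · (2·1.25507/k + (log k)/(k-1)). -/
open Finset in
/-- Generalized Chebyshev function `θ(x; k, ℓ) = Σ_{p ≤ x, p ≡ ℓ (mod k)} log p`. -/
noncomputable def theta (x : ℝ) (k l : ℕ) : ℝ :=
  ∑ p ∈ (Finset.range (Nat.floor x + 1)).filter
      (fun p => p.Prime ∧ p % k = l % k), Real.log p

/-- The part of `N!` coprime to the prime `k` divides the product of any `N` consecutive terms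
of an arithmetic progression of difference `k`. -/
theorem ordCompl_factorial_dvd_prod_arith {k : ℕ} (hk : k.Prime) (l N : ℕ) :
    ordCompl[k] N.factorial ∣ ∏ j ∈ Finset.range N, (l + k * j) := by
  have hN := N.factorial_ne_zero
  set M := ordCompl[k] N.factorial
  have hdvd : M ∣ N.factorial := Nat.ordCompl_dvd _ _
  have : NeZero M := ⟨(Nat.ordCompl_pos k hN).ne'⟩
  have hunit : (k : ZMod M) * (k : ZMod M)⁻¹ = 1 :=
    ZMod.coe_mul_inv_eq_one k (Nat.coprime_ordCompl hk hN)
  rw [← ZMod.natCast_eq_zero_iff]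
  set v := ((k : ZMod M)⁻¹).val
  have hv : (k : ZMod M) * (v : ZMod M) = 1 := by
    rw [ZMod.natCast_zmod_val, hunit]
  have hasc : (((l * v).ascFactorial N : ℕ) : ZMod M) = 0 :=
    (ZMod.natCast_eq_zero_iff _ _).2 (hdvd.trans (Nat.factorial_dvd_ascFactorial _ _))
  calc ((∏ j ∈ Finset.range N, (l + k * j) : ℕ) : ZMod M)
      = (k : ZMod M) ^ N * (((l * v).ascFactorial N : ℕ) : ZMod M) := by
        rw [Nat.ascFactorial_eq_prod_range]
        push_cast
        have hpow : (k : ZMod M) ^ N = ∏ _j ∈ Finset.range N, (k : ZMod M) := by simp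
        rw [hpow, ← Finset.prod_mul_distrib]
        refine Finset.prod_congr rfl fun j _ => ?_
        linear_combination (-(l : ZMod M)) * hv
    _ = 0 := by rw [hasc, mul_zero]

/-- A product of distinct primes exceeding `N`, each among the first `N` terms of the progression
`l, l + k, l + 2k, …`, is at most `k ^ (N + v_k(N!))`. -/
theorem prod_primes_arith_le {k l N : ℕ} (hk : k.Prime) (hl : 0 < l) (hlk : l < k)
    (S : Finset ℕ) (hS : ∀ p ∈ S, p.Prime ∧ N < p ∧ ∃ j < N, p = l + k * j) :
    ∏ p ∈ S, p ≤ k ^ (N + N.factorial.factorization k) := by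
  obtain ⟨Q, hQ⟩ := ordCompl_factorial_dvd_prod_arith hk l N
  have hM := Nat.ordCompl_pos k N.factorial_ne_zero
  have hMN := Nat.ordProj_mul_ordCompl_eq_self N.factorial k
  have hMdvd := Nat.ordCompl_dvd N.factorial k
  set M := ordCompl[k] N.factorial
  have hpos : 0 < ∏ j ∈ Finset.range N, (l + k * j) :=
    Finset.prod_pos fun j _ => by omega
  have hQpos : 0 < Q := Nat.pos_of_ne_zero fun h => by simp [h] at hQ; omega
  have hdvd : ∏ p ∈ S, p ∣ M * Q := by
    rw [← hQ]
    refine Finset.prod_primes_dvd _ (fun p hp => (hS p hp).1.prime) fun p hp => ?_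
    obtain ⟨-, -, j, hj, rfl⟩ := hS p hp
    exact Finset.dvd_prod_of_mem (fun j => l + k * j) (Finset.mem_range.2 hj)
  have hcop : Nat.Coprime (∏ p ∈ S, p) M := by
    refine Nat.Coprime.prod_left fun p hp => ?_
    obtain ⟨hpp, hNp, -⟩ := hS p hp
    refine (hpp.coprime_iff_not_dvd).2 fun h => ?_
    exact absurd (hpp.dvd_factorial.1 (h.trans hMdvd)) (by omega)
  refine (Nat.le_of_dvd hQpos (hcop.dvd_of_dvd_mul_left hdvd)).trans ?_
  refine Nat.le_of_mul_le_mul_left ?_ hM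
  calc M * Q = ∏ j ∈ Finset.range N, (l + k * j) := hQ.symm
    _ ≤ ∏ j ∈ Finset.range N, (k * (j + 1)) :=
        Finset.prod_le_prod' fun j _ => by rw [mul_add]; omega
    _ = k ^ N * N.factorial := by
        rw [Finset.prod_mul_distrib, Finset.prod_range_add_one_eq_factorial]; simp
    _ = M * k ^ (N + N.factorial.factorization k) := by
        rw [pow_add, mul_left_comm, mul_comm M, hMN]

/-- An explicit upper bound for `theta` in terms of the number `N` of terms of the progression. -/
theorem theta_le_of_terms {k l : ℕ} (hk : k.Prime) (hl : 0 < l) (hlk : l < k) (x : ℝ) {N : ℕ}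
    (hN : N = ⌊x⌋₊ / k + 1) :
    theta x k l ≤
      Real.log 4 * N + (N + N.factorial.factorization k : ℕ) * Real.log k := by
  unfold theta
  rw [← Finset.sum_filter_add_sum_filter_not _ (fun p => p ≤ N)]
  refine add_le_add ?_ ?_
  · refine le_trans ?_ (Chebyshev.theta_le_log4_mul_x (Nat.cast_nonneg N))
    rw [Chebyshev.theta, Nat.floor_natCast]
    refine Finset.sum_le_sum_of_subset_of_nonneg (fun p hp => ?_) fun p hp _ => ?_
    · simp only [Finset.mem_filter, Finset.mem_Ioc] at hp ⊢
      exact ⟨⟨hp.1.2.1.pos, hp.2⟩, hp.1.2.1⟩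
    · exact Real.log_natCast_nonneg p
  · set S := {p ∈ {p ∈ Finset.range (⌊x⌋₊ + 1) | p.Prime ∧ p % k = l % k} | ¬ p ≤ N} with hSdef
    have hS : ∀ p ∈ S, p.Prime ∧ N < p ∧ ∃ j < N, p = l + k * j := by
      intro p hp
      simp only [hSdef, Finset.mem_filter, Finset.mem_range, not_le] at hp
      obtain ⟨⟨hpx, hpp, hpk⟩, hpN⟩ := hp
      refine ⟨hpp, hpN, p / k, ?_, ?_⟩
      · rw [hN]
        exact Nat.lt_succ_of_le (Nat.div_le_div_right (by omega))
      · rw [Nat.mod_eq_of_lt hlk] at hpk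
        rw [← hpk, Nat.mod_add_div]
    have hle := prod_primes_arith_le hk hl hlk S hS
    rw [← Real.log_prod fun p hp => Nat.cast_ne_zero.2 (hS p hp).1.ne_zero, ← Real.log_pow]
    refine Real.log_le_log (Finset.prod_pos fun p hp => Nat.cast_pos.2 (hS p hp).1.pos) ?_
    rw [← Nat.cast_prod, ← Nat.cast_pow]
    exact Nat.cast_le.2 hle

theorem theta_upper_bound (l k : ℕ) (hl : 0 < l) (hk : k.Prime) (hlk : l < k) :
    ∀ x : ℝ, (k : ℝ) * ((k : ℝ) + 1) ≤ x →
      theta x k l ≤ x * (2 * 1.25507 / (k : ℝ) + Real.log k / ((k : ℝ) - 1)) := by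
  intro x hx
  have hk2 : (2 : ℝ) ≤ k := mod_cast hk.two_le
  have hk0 : (0 : ℝ) < k := by linarith
  have hk1 : (0 : ℝ) < k - 1 := by linarith
  have hx0 : 0 ≤ x := le_trans (by positivity) hx
  obtain ⟨N, hN⟩ : ∃ N, N = ⌊x⌋₊ / k + 1 := ⟨_, rfl⟩
  have hlog : Real.log k ≤ k - 1 := Real.log_le_sub_one_of_pos hk0
  have hlog0 : 0 ≤ Real.log k := Real.log_natCast_nonneg k
  have hlog4 : Real.log 4 ≤ 1.3864 := by
    have h : Real.log 4 = 2 * Real.log 2 := by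
      rw [show (4 : ℝ) = 2 ^ 2 by norm_num, Real.log_pow]; norm_num
    linarith [Real.log_two_lt_d9]
  set y := x / k with hy
  have hyk : (k : ℝ) + 1 ≤ y := by
    rw [hy, le_div_iff₀ hk0]; linarith
  have hNy : (N : ℝ) - 1 ≤ y := by
    rw [hN]; push_cast
    have h1 : ((⌊x⌋₊ / k : ℕ) : ℝ) ≤ (⌊x⌋₊ : ℝ) / k := Nat.cast_div_le
    have h2 : (⌊x⌋₊ : ℝ) / k ≤ x / k :=
      div_le_div_of_nonneg_right (Nat.floor_le hx0) hk0.le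
    linarith
  set v := N.factorial.factorization k with hv
  have hvN : ((k : ℝ) - 1) * v ≤ N - 1 := by
    have : Fact k.Prime := ⟨hk⟩
    have h := sub_one_mul_padicValNat_factorial_lt_of_ne_zero (p := k) (n := N)
      (by rw [hN]; exact Nat.succ_ne_zero _)
    rw [← Nat.factorization_def _ hk, ← hv] at h
    have h' : (k - 1) * v + 1 ≤ N := h
    have h'' : (((k - 1) * v + 1 : ℕ) : ℝ) ≤ N := mod_cast h'
    rw [Nat.cast_add, Nat.cast_mul, Nat.cast_sub hk.one_le] at h''
    push_cast at h''
    linarith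
  have hvy : (v : ℝ) ≤ y / (k - 1) := by
    rw [le_div_iff₀ hk1]; linarith
  have hmain := theta_le_of_terms hk hl hlk x hN
  rw [← hv] at hmain
  push_cast at hmain
  have hrhs : x * (2 * 1.25507 / (k : ℝ) + Real.log k / ((k : ℝ) - 1)) =
      2.51014 * y + (y + y / (k - 1)) * Real.log k := by
    have : x = y * k := by rw [hy]; field_simp
    rw [this]
    field_simp
    ring
  rw [hrhs]
  have h1 : Real.log 4 * N ≤ 1.3864 * (y + 1) :=
    mul_le_mul hlog4 (by linarith) (Nat.cast_nonneg N) (by norm_num)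
  have h2 : ((N : ℝ) + v) * Real.log k ≤ (y + 1 + y / (k - 1)) * Real.log k :=
    mul_le_mul_of_nonneg_right (by linarith) hlog0
  linarith
end

section
/- Let a and b be two coprime positive integers with a < b. Then for every integer n ≥ b + 1, we have ∏_{p ≤ n, p prime} p^(ϑ_p(L_{a,b,n})) ≤ 12.30641^n / (a + n·b)^(ω(b)). -/
open Finset in
/-- The product over the primes `p ≤ n` of the largest power of `p` not exceeding `N`. -/
def primePowerProd (n N : ℕ) : ℕ :=
  ∏ p ∈ (range (n + 1)).filter Nat.Prime, p ^ Nat.log p N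

lemma factorization_L_le_log {a b n N p : ℕ} (ha : 0 < a) (hp : p.Prime) (hN : a + n * b ≤ N) :
    (L a b n).factorization p ≤ Nat.log p N := by
  rw [L, Finset.factorization_lcm (fun k _ => by omega)]
  refine Finset.sup_le fun k hk => ?_
  have hk' : k ≤ n := by simpa [Nat.lt_succ_iff] using hk
  have hkN : a + k * b ≤ N := by nlinarith [Nat.mul_le_mul_right b hk']
  exact Nat.le_log_of_pow_le hp.one_lt ((Nat.ordProj_le p (by omega)).trans hkN)

lemma factorization_L_eq_zero {a b n p : ℕ} (hcop : Nat.Coprime a b) (ha : 0 < a)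
    (hp : p.Prime) (hpb : p ∣ b) : (L a b n).factorization p = 0 := by
  rw [L, Finset.factorization_lcm (fun k _ => by omega), ← Nat.le_zero]
  refine Finset.sup_le fun k _ => ?_
  refine (Nat.factorization_eq_zero_of_not_dvd fun h => ?_).le
  have hpa : p ∣ a := (Nat.dvd_add_left (hpb.mul_left k)).1 h
  exact hp.one_lt.ne' (Nat.eq_one_of_dvd_coprimes hcop hpa hpb)

open Finset in
lemma prod_factorization_L_mul_pow_le {a b n : ℕ} (ha : 0 < a) (hb : 0 < b) (hab : a < b)
    (hcop : Nat.Coprime a b) (hn : b + 1 ≤ n) :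
    (∏ p ∈ (range (n + 1)).filter Nat.Prime, p ^ ((L a b n).factorization p)) *
      (a + n * b) ^ b.primeFactors.card ≤ n * primePowerProd n (n ^ 2) := by
  have hN : a + n * b < n ^ 2 := by nlinarith
  have hset : ((range (n + 1)).filter Nat.Prime).filter (· ∣ b) = b.primeFactors := by
    ext p
    simp only [mem_filter, mem_range, Nat.mem_primeFactors]
    constructor
    · rintro ⟨⟨_, hp⟩, h⟩
      exact ⟨hp, h, hb.ne'⟩
    · rintro ⟨hp, h, _⟩
      exact ⟨⟨by linarith [Nat.le_of_dvd hb h], hp⟩, h⟩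
  have hpow : (a + n * b) ^ b.primeFactors.card =
      ∏ p ∈ (range (n + 1)).filter Nat.Prime, if p ∣ b then a + n * b else 1 := by
    rw [← prod_filter, hset, prod_const]
  have hrad : ∏ p ∈ (range (n + 1)).filter Nat.Prime, (if p ∣ b then p else 1) ≤ n := by
    rw [← prod_filter, hset]
    exact (Nat.le_of_dvd hb b.prod_primeFactors_dvd).trans (by omega)
  calc _ = ∏ p ∈ (range (n + 1)).filter Nat.Prime,
        p ^ ((L a b n).factorization p) * (if p ∣ b then a + n * b else 1) := by
        rw [hpow, prod_mul_distrib]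
    _ ≤ ∏ p ∈ (range (n + 1)).filter Nat.Prime,
        (if p ∣ b then p else 1) * p ^ Nat.log p (n ^ 2) := by
        refine prod_le_prod' fun p hp => ?_
        have hp := (mem_filter.1 hp).2
        split_ifs with h
        · rw [factorization_L_eq_zero hcop ha hp h, pow_zero, one_mul, ← pow_succ']
          exact (hN.trans (Nat.lt_pow_succ_log_self hp.one_lt _)).le
        · rw [mul_one, one_mul]
          exact Nat.pow_le_pow_right hp.pos (factorization_L_le_log ha hp hN.le)
    _ ≤ _ := by
        rw [prod_mul_distrib]
        exact Nat.mul_le_mul_right _ hrad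

lemma factorial_add_mul_pow_le (a b x y : ℕ) :
    (a + b).factorial * x ^ a * y ^ b ≤ a.factorial * b.factorial * (x + y) ^ (a + b) := by
  have h : x ^ a * y ^ b * (a + b).choose a ≤ (x + y) ^ (a + b) := by
    rw [add_pow]
    have := Finset.single_le_sum (f := fun m => x ^ m * y ^ (a + b - m) * ((a + b).choose m))
      (s := Finset.range (a + b + 1)) (fun _ _ => Nat.zero_le _)
      (Finset.mem_range.2 (by omega : a < a + b + 1))
    simpa using this
  rw [← Nat.add_choose_mul_factorial_mul_factorial]
  calc _ = a.factorial * b.factorial * (x ^ a * y ^ b * (a + b).choose a) := by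
        rw [← Nat.choose_symm_add]; ring
    _ ≤ _ := Nat.mul_le_mul_left _ h

lemma factorial_add_four_le (i j k m : ℕ) :
    (i + (j + (k + m))).factorial ≤
      i.factorial * j.factorial * k.factorial * m.factorial *
        (2 ^ i * 3 ^ j * 7 ^ k * 42 ^ m) := by
  have h1 := factorial_add_mul_pow_le k m 6 1
  have h2 := factorial_add_mul_pow_le j (k + m) 14 7
  have h3 := factorial_add_mul_pow_le i (j + (k + m)) 21 21
  norm_num at h1 h2 h3
  refine le_of_mul_le_mul_right (a := 21 ^ i * 14 ^ j * 6 ^ k * (21 ^ (j + (k + m)) * 7 ^ (k + m)))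
    ?_ (by positivity)
  calc _ = ((i + (j + (k + m))).factorial * 21 ^ i * 21 ^ (j + (k + m))) * 14 ^ j * 6 ^ k *
          7 ^ (k + m) := by ring
    _ ≤ (i.factorial * (j + (k + m)).factorial * 42 ^ (i + (j + (k + m)))) * 14 ^ j * 6 ^ k *
          7 ^ (k + m) := by gcongr
    _ = ((j + (k + m)).factorial * 14 ^ j * 7 ^ (k + m)) * i.factorial *
          42 ^ (i + (j + (k + m))) * 6 ^ k := by ring
    _ ≤ (j.factorial * (k + m).factorial * 21 ^ (j + (k + m))) * i.factorial *
          42 ^ (i + (j + (k + m))) * 6 ^ k := by gcongr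
    _ = ((k + m).factorial * 6 ^ k) * j.factorial * 21 ^ (j + (k + m)) * i.factorial *
          42 ^ (i + (j + (k + m))) := by ring
    _ ≤ (k.factorial * m.factorial * 7 ^ (k + m)) * j.factorial * 21 ^ (j + (k + m)) *
          i.factorial * 42 ^ (i + (j + (k + m))) := by gcongr
    _ = _ := by
      have e1 : (42 : ℕ) ^ i = 2 ^ i * 21 ^ i := by rw [← mul_pow]; norm_num
      have e2 : (42 : ℕ) ^ j = 3 ^ j * 14 ^ j := by rw [← mul_pow]; norm_num
      have e3 : (42 : ℕ) ^ k = 7 ^ k * 6 ^ k := by rw [← mul_pow]; norm_num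
      rw [pow_add 42 i, pow_add 42 j, pow_add 42 k, e1, e2, e3]
      ring

/-- Since `1/2 + 1/3 + 1/7 + 1/42 = 1`, the sum `y/2 + y/3 + y/7 + y/42` of floors is at most `y`,
and less than `y` for `1 ≤ y < 42`; Legendre's formula turns this into a valuation bound. -/
lemma factorization_factorials_lt {n p : ℕ} (hp : p.Prime) (hpn : p ≤ n) (hnp : n / 42 < p) :
    ((n / 2).factorial * (n / 3).factorial * (n / 7).factorial *
      (n / 42).factorial).factorization p < n.factorial.factorization p := by
  have hlog : ∀ d, Nat.log p (n / d) < Nat.log p n + 1 := fun d =>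
    Nat.lt_succ_of_le (Nat.log_mono_right (Nat.div_le_self _ _))
  have hf : ∀ m : ℕ, m.factorial ≠ 0 := Nat.factorial_ne_zero
  rw [Nat.factorization_mul (by simp [hf]) (hf _), Nat.factorization_mul (by simp [hf]) (hf _),
    Nat.factorization_mul (hf _) (hf _)]
  simp only [Finsupp.add_apply]
  rw [Nat.factorization_factorial hp (hlog 2), Nat.factorization_factorial hp (hlog 3),
    Nat.factorization_factorial hp (hlog 7), Nat.factorization_factorial hp (hlog 42),
    Nat.factorization_factorial hp (Nat.lt_succ_self _), ← Finset.sum_add_distrib,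
    ← Finset.sum_add_distrib, ← Finset.sum_add_distrib]
  have hcomm : ∀ d i, n / d / p ^ i = n / p ^ i / d := fun d i => by
    rw [Nat.div_div_eq_div_mul, Nat.div_div_eq_div_mul, mul_comm]
  simp only [hcomm]
  refine Finset.sum_lt_sum (fun i _ => by omega) ⟨1, ?_, ?_⟩
  · have : 0 < Nat.log p n := Nat.log_pos hp.one_lt hpn
    rw [Finset.mem_Ico]; omega
  · have h1 : 1 ≤ n / p ^ 1 := by rw [pow_one]; exact Nat.div_pos hpn hp.pos
    have h2 : n / p ^ 1 < 42 := by
      rw [pow_one, Nat.div_lt_iff_lt_mul hp.pos]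
      omega
    omega

open Finset in
lemma prod_primes_mul_factorials_le (n : ℕ) :
    (∏ p ∈ (Ico (n / 42 + 1) (n + 1)).filter Nat.Prime, p) *
      ((n / 2).factorial * (n / 3).factorial * (n / 7).factorial * (n / 42).factorial) ≤
      n.factorial := by
  have hf : ∀ m : ℕ, m.factorial ≠ 0 := Nat.factorial_ne_zero
  set D := (n / 2).factorial * (n / 3).factorial * (n / 7).factorial * (n / 42).factorial with hD
  have hD0 : D ≠ 0 := by simp [hD, hf]
  have hdvd : D ∣ n.factorial := by
    have hsum : n / 2 + (n / 3 + (n / 7 + n / 42)) ≤ n := by omega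
    refine dvd_trans ?_ (Nat.factorial_dvd_factorial hsum)
    have h1 := Nat.factorial_mul_factorial_dvd_factorial_add (n / 7) (n / 42)
    have h2 := Nat.factorial_mul_factorial_dvd_factorial_add (n / 3) (n / 7 + n / 42)
    have h3 := Nat.factorial_mul_factorial_dvd_factorial_add (n / 2) (n / 3 + (n / 7 + n / 42))
    rw [hD, mul_assoc, mul_assoc]
    exact ((mul_dvd_mul_left _ ((mul_dvd_mul_left _ h1).trans h2)).trans h3)
  obtain ⟨M, hM⟩ := hdvd
  have hM0 : M ≠ 0 := by rintro rfl; exact hf n (by simpa using hM)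
  rw [hM, mul_comm]
  refine Nat.mul_le_mul_left _ (Nat.le_of_dvd (Nat.pos_of_ne_zero hM0) ?_)
  refine Finset.prod_primes_dvd _ (fun p hp => (mem_filter.1 hp).2.prime) fun p hp => ?_
  obtain ⟨hp, hpp⟩ := mem_filter.1 hp
  rw [mem_Ico] at hp
  have hlt := factorization_factorials_lt hpp (by omega : p ≤ n) (by omega)
  rw [← hD, hM, Nat.factorization_mul hD0 hM0] at hlt
  exact Nat.dvd_of_factorization_pos (by simp at hlt; omega)

lemma primorial_le_mul_primorial_div {n : ℕ} (hn : 0 < n) :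
    primorial n ≤ n ^ 3 * (2 ^ (n / 2) * 3 ^ (n / 3) * 7 ^ (n / 7) * 42 ^ (n / 42)) *
      primorial (n / 42) := by
  have h1 := primorial_add (n / 42) (n - n / 42)
  rw [Nat.add_sub_cancel' (Nat.div_le_self n 42)] at h1
  rw [h1, mul_comm]
  refine Nat.mul_le_mul_right _ ?_
  have h2 := prod_primes_mul_factorials_le n
  have h3 := factorial_add_four_le (n / 2) (n / 3) (n / 7) (n / 42)
  set S := n / 2 + (n / 3 + (n / 7 + n / 42)) with hS
  have h4 : n.factorial ≤ S.factorial * n ^ 3 := by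
    have hle : n - S ≤ n := Nat.sub_le _ _
    rw [← Nat.factorial_mul_descFactorial hle, Nat.sub_sub_self (by omega : S ≤ n)]
    refine Nat.mul_le_mul_left _ ((Nat.descFactorial_le_pow _ _).trans ?_)
    exact Nat.pow_le_pow_right hn (by omega)
  refine le_of_mul_le_mul_right (h2.trans (h4.trans ?_)) (by positivity)
  calc _ ≤ _ := Nat.mul_le_mul_right (n ^ 3) h3
    _ = _ := by ring

/-- A decidable superset of the primes: the numbers `k ≥ 2` with no prime divisor `d ≤ 61` other than `k`. -/
def sieve (k : ℕ) : Bool :=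
  Nat.blt 1 k && [2, 3, 5, 7, 11, 13, 17, 19, 23, 29, 31, 37, 41, 43, 47, 53, 59, 61].all
    fun d => k % d != 0 || k == d

lemma sieve_of_prime {p : ℕ} (hp : p.Prime) : sieve p = true := by
  rw [sieve, Bool.and_eq_true, List.all_eq_true]
  refine ⟨by simpa [Nat.blt_eq] using hp.one_lt, fun d hd => ?_⟩
  have hd1 : d ≠ 1 := by rintro rfl; simp at hd
  rcases Nat.eq_zero_or_pos (p % d) with h | h
  · have := (hp.eq_one_or_self_of_dvd d (Nat.dvd_of_mod_eq_zero h)).resolve_left hd1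
    simp [this]
  · simp [h.ne']

/-- Upper bound for the largest power of `p` not exceeding `N`, searching from the power `acc`
upwards with at most `fuel` multiplications. -/
def maxPow (p N : ℕ) : ℕ → ℕ → ℕ
  | 0, _ => N
  | fuel + 1, acc => if Nat.blt N (acc * p) then acc else maxPow p N fuel (acc * p)

lemma pow_log_le_maxPow {p N : ℕ} (hN : N ≠ 0) (fuel i : ℕ) :
    p ^ Nat.log p N ≤ maxPow p N fuel (p ^ i) := by
  induction fuel generalizing i with
  | zero => exact Nat.pow_log_le_self p hN
  | succ f ih =>
    rw [maxPow, ← pow_succ]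
    split_ifs with h
    · rw [Nat.blt_eq] at h
      rcases Nat.eq_zero_or_pos p with rfl | hp
      · simp at h
      · exact Nat.pow_le_pow_right hp (Nat.lt_succ_iff.1 (Nat.log_lt_of_lt_pow hN h))
    · exact ih (i + 1)

/-- The product of `g k` over the `k ≤ m` passing the sieve. -/
def sieveProd (g : ℕ → ℕ) : ℕ → ℕ
  | 0 => 1
  | k + 1 => bif sieve (k + 1) then g (k + 1) * sieveProd g k else sieveProd g k

open Finset in
lemma prod_primes_le_sieveProd {f g : ℕ → ℕ} (hfg : ∀ p, p.Prime → f p ≤ g p)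
    (hg : ∀ k, 0 < k → 0 < g k) (m : ℕ) :
    ∏ p ∈ (range (m + 1)).filter Nat.Prime, f p ≤ sieveProd g m := by
  induction m with
  | zero => simp [sieveProd, filter_singleton, Nat.not_prime_zero]
  | succ m ih =>
    rw [range_add_one, filter_insert, sieveProd]
    split_ifs with h
    · rw [prod_insert (by simp), sieve_of_prime h]
      exact Nat.mul_le_mul (hfg _ h) ih
    · cases sieve (m + 1)
      · exact ih
      · exact ih.trans (Nat.le_mul_of_pos_left _ (hg _ m.succ_pos))

open Finset in
lemma primePowerProd_mono {m n M N : ℕ} (hmn : m ≤ n) (hMN : M ≤ N) :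
    primePowerProd m M ≤ primePowerProd n N := by
  refine (prod_le_prod' fun p hp => ?_).trans
    (prod_le_prod_of_subset_of_one_le' (filter_subset_filter _ (by gcongr)) fun p hp _ => ?_)
  · exact Nat.pow_le_pow_right (mem_filter.1 hp).2.pos (Nat.log_mono_right hMN)
  · exact Nat.one_le_pow _ _ (mem_filter.1 hp).2.pos

/-- The two exponential bounds, in denominator-free form. -/
def ExpBounds (n : ℕ) : Prop :=
  10 ^ n * (n * primePowerProd n (n ^ 2)) ≤ 123 ^ n ∧ 10 ^ n * primorial n ≤ 31 ^ n

/-- Certifies `ExpBounds` on the interval `[s, e]`. -/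
def checkInterval (s e : ℕ) : Bool :=
  Nat.ble (10 ^ s * (e * sieveProd (fun p => maxPow p (e ^ 2) 25 1) e)) (123 ^ s) &&
    Nat.ble (10 ^ s * sieveProd id e) (31 ^ s)

/-- Runs `checkInterval` on consecutive intervals starting at `s` with the given right ends. -/
def checkChain : ℕ → List ℕ → Bool
  | _, [] => true
  | s, e :: l => checkInterval s e && checkChain (e + 1) l

lemma ten_pow_mul_le {s n c X Y : ℕ} (hc : 10 ≤ c) (hsn : s ≤ n) (hXY : X ≤ Y)
    (h : 10 ^ s * Y ≤ c ^ s) : 10 ^ n * X ≤ c ^ n := by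
  obtain ⟨k, rfl⟩ := Nat.exists_eq_add_of_le hsn
  calc 10 ^ (s + k) * X = 10 ^ s * X * 10 ^ k := by ring
    _ ≤ 10 ^ s * Y * 10 ^ k := by gcongr
    _ ≤ c ^ s * c ^ k := Nat.mul_le_mul h (Nat.pow_le_pow_left hc k)
    _ = _ := (pow_add ..).symm

lemma maxPow_pos {p N : ℕ} (hp : 0 < p) (hN : N ≠ 0) (fuel : ℕ) : 0 < maxPow p N fuel 1 :=
  (Nat.pow_pos hp).trans_le (by simpa using pow_log_le_maxPow (p := p) hN fuel 0)

lemma expBounds_of_checkInterval {s e n : ℕ} (he : 0 < e) (h : checkInterval s e = true)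
    (hs : s ≤ n) (hn : n ≤ e) : ExpBounds n := by
  rw [checkInterval, Bool.and_eq_true, Nat.ble_eq, Nat.ble_eq] at h
  have he2 : e ^ 2 ≠ 0 := by positivity
  refine ⟨ten_pow_mul_le (by norm_num) hs (Nat.mul_le_mul hn ?_) h.1,
    ten_pow_mul_le (by norm_num) hs ?_ h.2⟩
  · refine (primePowerProd_mono hn (Nat.pow_le_pow_left hn 2)).trans
      (prod_primes_le_sieveProd (fun p _ => ?_) (fun k hk => maxPow_pos hk he2 _) e)
    simpa using pow_log_le_maxPow (p := p) he2 25 0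
  · exact (primorial_mono hn).trans
      (prod_primes_le_sieveProd (g := id) (fun p _ => le_rfl) (fun k hk => hk) e)

lemma expBounds_of_checkChain {s n : ℕ} {l : List ℕ} (h : checkChain s l = true) (hs : s ≤ n)
    (hl : ∃ e ∈ l, n ≤ e) : ExpBounds n := by
  induction l generalizing s with
  | nil => simp at hl
  | cons e l ih =>
    rw [checkChain, Bool.and_eq_true] at h
    rcases le_or_gt n e with hne | hne
    · rcases Nat.eq_zero_or_pos e with rfl | he
      · obtain rfl : n = 0 := by omega
        simp [ExpBounds]
      · exact expBounds_of_checkInterval he h.1 hs hne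
    · refine ih h.2 hne ?_
      obtain ⟨e', he', hn⟩ := hl
      rcases List.mem_cons.1 he' with rfl | he'
      · omega
      · exact ⟨e', he', hn⟩

lemma expBounds_of_le {n : ℕ} (h3 : 3 ≤ n) (hn : n ≤ 4260) : ExpBounds n := by
  have h : checkChain 3 [4, 6, 8, 10, 12, 16, 18, 22, 28, 36, 42, 48, 58, 70, 82, 100, 112, 136,
      162, 192, 232, 276, 336, 401, 478, 576, 676, 810, 966, 1122, 1302, 1522, 1776, 2080, 2398,
      2766, 3216, 3708, 4260] = true := by decide +kernel
  exact expBounds_of_checkChain h h3 ⟨4260, by simp, hn⟩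

lemma add_one_le_forty_one_mul_log :
    22 * Real.log 2 + 15 * Real.log 3 + 7 * Real.log 7 + 1 ≤ 41 * Real.log 3.1 := by
  have h : Real.exp 1 * (2 ^ 22 * 3 ^ 15 * 7 ^ 7) ≤ (3.1 : ℝ) ^ 41 := by
    have := Real.exp_one_lt_d9
    calc _ ≤ 2.7182818286 * ((2 : ℝ) ^ 22 * 3 ^ 15 * 7 ^ 7) := by gcongr
      _ ≤ _ := by norm_num
  have h2 := Real.log_le_log (by positivity) h
  rw [Real.log_mul (by positivity) (by positivity), Real.log_exp,
    Real.log_mul (by positivity) (by positivity), Real.log_mul (by positivity) (by positivity),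
    Real.log_pow, Real.log_pow, Real.log_pow, Real.log_pow] at h2
  push_cast at h2
  linarith

lemma primorial_le_pow_of_div {n : ℕ} (hn : 4096 ≤ n)
    (ih : (primorial (n / 42) : ℝ) ≤ 3.1 ^ (n / 42)) : (primorial n : ℝ) ≤ 3.1 ^ n := by
  have h1 : (primorial n : ℝ) ≤ n ^ 3 * (2 ^ (n / 2) * 3 ^ (n / 3) * 7 ^ (n / 7) *
      42 ^ (n / 42)) * primorial (n / 42) := by
    exact_mod_cast primorial_le_mul_primorial_div (by omega : 0 < n)
  have hn0 : (0 : ℝ) < n := by exact_mod_cast (by omega : 0 < n)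
  have hn' : (4096 : ℝ) ≤ n := by exact_mod_cast hn
  refine (h1.trans (mul_le_mul_of_nonneg_left ih (by positivity))).trans ?_
  rw [← Real.log_le_log_iff (by positivity) (by positivity)]
  have hlog42 : Real.log 42 = Real.log 2 + Real.log 3 + Real.log 7 := by
    rw [← Real.log_mul (by norm_num) (by norm_num), ← Real.log_mul (by norm_num) (by norm_num)]
    norm_num
  rw [Real.log_mul (by positivity) (by positivity), Real.log_mul (by positivity) (by positivity),
    Real.log_mul (by positivity) (by positivity), Real.log_mul (by positivity) (by positivity),
    Real.log_mul (by positivity) (by positivity)]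
  simp only [Real.log_pow]
  rw [hlog42]
  have e2 : ((n / 2 : ℕ) : ℝ) ≤ n / 2 := by exact_mod_cast Nat.cast_div_le
  have e3 : ((n / 3 : ℕ) : ℝ) ≤ n / 3 := by exact_mod_cast Nat.cast_div_le
  have e7 : ((n / 7 : ℕ) : ℝ) ≤ n / 7 := by exact_mod_cast Nat.cast_div_le
  have e42 : ((n / 42 : ℕ) : ℝ) ≤ n / 42 := by exact_mod_cast Nat.cast_div_le
  have l2 : 0 < Real.log 2 := Real.log_pos (by norm_num)
  have l3 : 0 < Real.log 3 := Real.log_pos (by norm_num)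
  have l7 : 0 < Real.log 7 := Real.log_pos (by norm_num)
  have lK : 0 < Real.log 3.1 := Real.log_pos (by norm_num)
  have f2 := mul_le_mul_of_nonneg_right e2 l2.le
  have f3 := mul_le_mul_of_nonneg_right e3 l3.le
  have f7 := mul_le_mul_of_nonneg_right e7 l7.le
  have f42 := mul_le_mul_of_nonneg_right e42 (add_pos (add_pos l2 l3) l7).le
  have fK := mul_le_mul_of_nonneg_right e42 lK.le
  have hmain := mul_le_mul_of_nonneg_left add_one_le_forty_one_mul_log hn0.le
  have hlogn : Real.log n ≤ 8.4 + (n / 4096 - 1) := by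
    have h := Real.log_le_sub_one_of_pos (show (0 : ℝ) < n / 4096 by positivity)
    rw [Real.log_div hn0.ne' (by norm_num), show (4096 : ℝ) = 2 ^ 12 by norm_num,
      Real.log_pow] at h
    have := Real.log_two_lt_d9
    push_cast at h
    norm_num at h ⊢
    linarith
  push_cast
  nlinarith

lemma primorial_le_pow (n : ℕ) : (primorial n : ℝ) ≤ 3.1 ^ n := by
  induction n using Nat.strong_induction_on with
  | _ n ih =>
    rcases lt_or_ge n 3 with h | h3
    · interval_cases n <;> simp <;> norm_num
    rcases le_or_gt n 4260 with h | h
    · have h : (10 : ℝ) ^ n * primorial n ≤ 31 ^ n := by exact_mod_cast (expBounds_of_le h3 h).2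
      rw [show (3.1 : ℝ) = 31 / 10 by norm_num, div_pow, le_div_iff₀ (by positivity)]
      linarith
    · exact primorial_le_pow_of_div (by omega) (ih _ (Nat.div_lt_self (by omega) (by norm_num)))

lemma primeCounting_le_half {s : ℕ} (hs : 16 ≤ s) : Nat.primeCounting s ≤ s / 2 := by
  have h := Nat.primeCounting'_add_le (a := 2) (k := 16) (by norm_num) (by norm_num) (s - 15)
  have h16 : Nat.primeCounting' 16 = 6 := by decide
  rw [h16, Nat.totient_two, show 16 + (s - 15) = s + 1 by omega] at h
  rw [Nat.primeCounting]
  omega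

open Finset in
lemma primePowerProd_sq_le {n r : ℕ} (hn : 256 ≤ n) (hr : ∀ p, p ^ 3 ≤ n ^ 2 → p ≤ r) :
    primePowerProd n (n ^ 2) ≤ primorial n ^ 2 * primorial r * n ^ n.sqrt := by
  have hn2 : n ^ 2 ≠ 0 := by positivity
  have hcard : #((range (n.sqrt + 1)).filter Nat.Prime) ≤ n.sqrt / 2 := by
    have h16 : 16 ≤ n.sqrt := by rw [Nat.le_sqrt]; omega
    have := primeCounting_le_half h16
    rwa [Nat.primeCounting, Nat.primeCounting', Nat.count_eq_card_filter_range] at this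
  have hone : ∀ {p m}, p ∈ (range (m + 1)).filter Nat.Prime → 1 ≤ p :=
    fun hp => (mem_filter.1 hp).2.pos
  calc primePowerProd n (n ^ 2)
      ≤ ∏ p ∈ (range (n + 1)).filter Nat.Prime,
          p ^ 2 * (if p ≤ r then p else 1) * (if p ≤ n.sqrt then n ^ 2 else 1) := by
        refine prod_le_prod' fun p hp => ?_
        have hp := (mem_filter.1 hp).2
        have hpow := Nat.pow_log_le_self p hn2
        have h1 : 1 ≤ if p ≤ r then p else 1 := by split_ifs <;> [exact hp.pos; rfl]
        by_cases hs : p ≤ n.sqrt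
        · rw [if_pos hs]
          exact hpow.trans (Nat.le_mul_of_pos_left _ (Nat.mul_pos (Nat.pow_pos hp.pos) h1))
        rw [if_neg hs, mul_one]
        split_ifs with hpr
        · rw [← pow_succ]
          refine Nat.pow_le_pow_right hp.pos (Nat.lt_succ_iff.1 (Nat.log_lt_of_lt_pow hn2 ?_))
          rw [not_le, Nat.sqrt_lt'] at hs
          have h4 := Nat.pow_lt_pow_left hs two_ne_zero
          rwa [← pow_mul] at h4
        · rw [mul_one]
          refine Nat.pow_le_pow_right hp.pos (Nat.lt_succ_iff.1 (Nat.log_lt_of_lt_pow hn2 ?_))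
          exact not_le.1 fun h => hpr (hr p h)
    _ = primorial n ^ 2 * (∏ p ∈ ((range (n + 1)).filter Nat.Prime).filter (· ≤ r), p) *
          ∏ p ∈ ((range (n + 1)).filter Nat.Prime).filter (· ≤ n.sqrt), n ^ 2 := by
        rw [prod_mul_distrib, prod_mul_distrib, prod_pow, prod_filter (· ≤ r),
          prod_filter (· ≤ n.sqrt), primorial]
    _ ≤ primorial n ^ 2 * primorial r *
          ∏ p ∈ (range (n.sqrt + 1)).filter Nat.Prime, n ^ 2 := by
        refine Nat.mul_le_mul (Nat.mul_le_mul_left _ ?_) ?_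
        · refine prod_le_prod_of_subset_of_one_le' (fun p hp => ?_) fun p hp _ => hone hp
          simp only [mem_filter, mem_range] at hp ⊢
          exact ⟨by omega, hp.1.2⟩
        · refine prod_le_prod_of_subset_of_one_le' (fun p hp => ?_)
            fun _ _ _ => Nat.one_le_pow _ _ (by omega)
          simp only [mem_filter, mem_range] at hp ⊢
          exact ⟨by omega, hp.1.2⟩
    _ ≤ _ := by
        rw [prod_const, ← pow_mul]
        gcongr
        · omega
        · omega

lemma log_ratio_ge : 0.24 ≤ Real.log (12.30641 / 3.1 ^ 2) := by
  have h : Real.exp 1 ^ 6 ≤ (12.30641 / 3.1 ^ 2 : ℝ) ^ 25 := by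
    calc _ ≤ (2.7182818286 : ℝ) ^ 6 := by
          have := Real.exp_one_lt_d9
          gcongr
      _ ≤ (1.28 : ℝ) ^ 25 := by norm_num
      _ ≤ _ := by gcongr; norm_num
  have h2 := Real.log_le_log (by positivity) h
  rw [Real.log_pow, Real.log_pow, Real.log_exp] at h2
  norm_num at h2 ⊢
  linarith

lemma mul_primePowerProd_le_of_large {n : ℕ} (hn : 4096 ≤ n) :
    (n * primePowerProd n (n ^ 2) : ℝ) ≤ 12.30641 ^ n := by
  have hn' : (4096 : ℝ) ≤ n := by exact_mod_cast hn
  have hn0 : (0 : ℝ) < n := by linarith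
  set x : ℝ := (n : ℝ) ^ (1 / 6 : ℝ) with hx
  have hx0 : 0 ≤ x := by positivity
  have hx6 : x ^ 6 = n := by
    rw [hx, ← Real.rpow_natCast, ← Real.rpow_mul hn0.le]
    norm_num
  have hx4 : 4 ≤ x := by
    refine le_of_pow_le_pow_left₀ (n := 6) (by norm_num) hx0 ?_
    rw [hx6]; norm_num; exact hn
  have hr : ∀ p : ℕ, p ^ 3 ≤ n ^ 2 → p ≤ ⌊x ^ 4⌋₊ := fun p hp => by
    refine Nat.le_floor (le_of_pow_le_pow_left₀ (n := 3) (by norm_num) (by positivity) ?_)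
    rw [show (x ^ 4) ^ 3 = (x ^ 6) ^ 2 by ring, hx6]
    exact_mod_cast hp
  have hs : (n.sqrt : ℝ) ≤ x ^ 3 := by
    refine le_of_pow_le_pow_left₀ (n := 2) (by norm_num) (by positivity) ?_
    rw [show (x ^ 3) ^ 2 = x ^ 6 by ring, hx6]
    exact_mod_cast Nat.sqrt_le' n
  have hprod : (primePowerProd n (n ^ 2) : ℝ) ≤
      primorial n ^ 2 * primorial ⌊x ^ 4⌋₊ * n ^ n.sqrt := by
    exact_mod_cast primePowerProd_sq_le (by omega) hr
  have hprim : (primorial ⌊x ^ 4⌋₊ : ℝ) ≤ 4 ^ ⌊x ^ 4⌋₊ := by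
    exact_mod_cast primorial_le_four_pow _
  have hbound : (n * primePowerProd n (n ^ 2) : ℝ) ≤
      n * ((3.1 ^ n) ^ 2 * 4 ^ ⌊x ^ 4⌋₊ * n ^ n.sqrt) := by
    refine mul_le_mul_of_nonneg_left (hprod.trans ?_) hn0.le
    have := primorial_le_pow n
    gcongr
  refine hbound.trans ?_
  rw [← Real.log_le_log_iff (by positivity) (by positivity),
    Real.log_mul (by positivity) (by positivity), Real.log_mul (by positivity) (by positivity),
    Real.log_mul (by positivity) (by positivity)]
  have hratio := log_ratio_ge
  rw [Real.log_div (by norm_num) (by norm_num), Real.log_pow] at hratio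
  simp only [Real.log_pow]
  have hr' : ((⌊x ^ 4⌋₊ : ℕ) : ℝ) ≤ x ^ 4 := Nat.floor_le (by positivity)
  have hlog2 := Real.log_two_lt_d9
  have hlog4 : Real.log 4 = 2 * Real.log 2 := by
    rw [show (4 : ℝ) = 2 ^ 2 by norm_num, Real.log_pow]; norm_num
  have hlogx : Real.log x ≤ x / 4 + 0.387 := by
    have h := Real.log_le_sub_one_of_pos (show (0 : ℝ) < x / 4 by positivity)
    rw [Real.log_div (by positivity) (by norm_num), hlog4] at h
    norm_num at h hlog2 ⊢
    linarith
  have hlogn : Real.log n = 6 * Real.log x := by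
    rw [← hx6, Real.log_pow]; norm_num
  have hlogx0 : 0 ≤ Real.log x := Real.log_nonneg (by linarith)
  have t1 : (⌊x ^ 4⌋₊ : ℝ) * Real.log 4 ≤ x ^ 4 * 1.3863 := by
    refine mul_le_mul hr' ?_ (by rw [hlog4]; positivity) (by positivity)
    norm_num at hlog2 ⊢
    linarith
  have t2 : (n.sqrt : ℝ) * Real.log n ≤ x ^ 3 * (6 * (x / 4 + 0.387)) := by
    rw [hlogn]
    exact mul_le_mul hs (by linarith) (by positivity) (by positivity)
  have t3 : Real.log n ≤ 6 * (x / 4 + 0.387) := by linarith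
  have t4 := mul_le_mul_of_nonneg_left hratio hn0.le
  have p4 : x ^ 3 * 4 ≤ x ^ 4 := by
    rw [pow_succ x 3]; gcongr
  have p6 : x ^ 4 * 16 ≤ x ^ 6 := by
    rw [show x ^ 6 = x ^ 4 * x ^ 2 by ring]
    gcongr; nlinarith
  have p3 : x * 16 ≤ x ^ 3 := by
    rw [show x ^ 3 = x * x ^ 2 by ring]
    gcongr; nlinarith
  have t5 : (n : ℝ) * 0.24 = x ^ 6 * 0.24 := by rw [hx6]
  push_cast at *
  nlinarith

lemma mul_primePowerProd_le {n : ℕ} (hn : 3 ≤ n) :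
    (n * primePowerProd n (n ^ 2) : ℝ) ≤ 12.30641 ^ n := by
  rcases le_or_gt n 4260 with h | h
  · have h : (10 : ℝ) ^ n * (n * primePowerProd n (n ^ 2)) ≤ 123 ^ n := by
      exact_mod_cast (expBounds_of_le hn h).1
    calc (n * primePowerProd n (n ^ 2) : ℝ) ≤ (123 / 10) ^ n := by
          rw [div_pow, le_div_iff₀ (by positivity)]
          linarith
      _ ≤ _ := by gcongr; norm_num
  · exact mul_primePowerProd_le_of_large (by omega)

open Finset in
theorem smooth_part_bound (a b : ℕ) (ha : 0 < a) (hb : 0 < b) (hab : a < b)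
    (hcop : Nat.Coprime a b) :
    ∀ n : ℕ, b + 1 ≤ n →
      ((∏ p ∈ (Finset.range (n + 1)).filter Nat.Prime,
          p ^ ((L a b n).factorization p) : ℕ) : ℝ) ≤
        (12.30641 : ℝ) ^ n / ((a : ℝ) + n * b) ^ b.primeFactors.card := by
  intro n hn
  have ha' : (0 : ℝ) < a := by exact_mod_cast ha
  rw [le_div_iff₀ (by positivity)]
  refine le_trans ?_ (mul_primePowerProd_le (by omega : 3 ≤ n))
  exact_mod_cast prod_factorization_L_mul_pow_le ha hb hab hcop hn
end

section
/- Let a and b be two coprime positive integers. Then for every natural number n, the integer ∏_{p > n, p prime} p^(ϑ_p(L_{a,b,n})) divides the integer ( a(a+b)(a+2b)···(a+nb) · ∏_{p ≤ n, p prime, p ∣ b} p^(ϑ_p(n!)) ) / ( n! · ∏_{p ≤ n, p prime, p ∤ b} p^(ϑ_p(n+1)) ), and in particular the latter expression is an integer. -/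
theorem factorization_prod_primes_pow (s : Finset ℕ) (hs : ∀ p ∈ s, p.Prime) (f : ℕ → ℕ) (q : ℕ) :
    (∏ p ∈ s, p ^ f p).factorization q = if q ∈ s then f q else 0 := by
  rw [Nat.factorization_prod_apply fun p hp => pow_ne_zero _ (hs p hp).ne_zero,
    ← Finset.sum_ite_eq s q f]
  refine Finset.sum_congr rfl fun p hp => ?_
  rw [(hs p hp).factorization_pow, Finsupp.single_apply]
  simp only [eq_comm]

theorem dvd_prod_add_mul_of_dvd_factorial {a b m n : ℕ} (hb : Nat.Coprime b m)
    (hm : m ∣ n.factorial) : m ∣ ∏ k ∈ Finset.range n, (a + k * b) := by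
  rw [← ZMod.natCast_eq_zero_iff]
  set c : ℕ := ((b : ZMod m)⁻¹).val
  have hbc : (b : ZMod m) * ((b : ZMod m)⁻¹) = 1 := ZMod.coe_mul_inv_eq_one b hb
  obtain rfl | hm0 := Nat.eq_zero_or_pos m
  · exact absurd (zero_dvd_iff.mp hm) n.factorial_ne_zero
  have : NeZero m := ⟨hm0.ne'⟩
  have hasc : (((a * c).ascFactorial n : ℕ) : ZMod m) = 0 :=
    (ZMod.natCast_eq_zero_iff _ _).mpr (hm.trans (Nat.factorial_dvd_ascFactorial _ _))
  have hprod : ((∏ k ∈ Finset.range n, (a + k * b) : ℕ) : ZMod m) =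
      (b : ZMod m) ^ n * (((a * c).ascFactorial n : ℕ) : ZMod m) := by
    rw [Nat.ascFactorial_eq_prod_range]
    push_cast
    rw [← Finset.card_range n, ← Finset.prod_const, Finset.card_range, ← Finset.prod_mul_distrib]
    refine Finset.prod_congr rfl fun k _ => ?_
    rw [ZMod.natCast_zmod_val]
    linear_combination (-(a : ZMod m)) * hbc
  rw [hprod, hasc, mul_zero]

theorem L_dvd_prod (a b n : ℕ) : L a b n ∣ ∏ k ∈ Finset.range (n + 1), (a + k * b) :=
  Finset.lcm_dvd fun _ hk => Finset.dvd_prod_of_mem (fun k => a + k * b) hk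

open Finset in
theorem rough_part_divides (a b : ℕ) (ha : 0 < a) (hb : 0 < b)
    (hcop : Nat.Coprime a b) (n : ℕ) :
    (n.factorial *
        ∏ p ∈ (Finset.range (n + 1)).filter (fun p => p.Prime ∧ ¬ p ∣ b),
          p ^ ((n + 1).factorization p)) ∣
      ((∏ k ∈ Finset.range (n + 1), (a + k * b)) *
        ∏ p ∈ b.primeFactors.filter (· ≤ n), p ^ ((n.factorial).factorization p)) ∧
    (∏ p ∈ (L a b n).primeFactors.filter (fun p => n < p),
        p ^ ((L a b n).factorization p)) ∣
      ((∏ k ∈ Finset.range (n + 1), (a + k * b)) *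
          ∏ p ∈ b.primeFactors.filter (· ≤ n), p ^ ((n.factorial).factorization p)) /
        (n.factorial *
          ∏ p ∈ (Finset.range (n + 1)).filter (fun p => p.Prime ∧ ¬ p ∣ b),
            p ^ ((n + 1).factorization p)) := by
  set P := ∏ k ∈ range (n + 1), (a + k * b) with hP
  set B := ∏ p ∈ b.primeFactors.filter (· ≤ n), p ^ ((n.factorial).factorization p) with hB
  set S := ∏ p ∈ (range (n + 1)).filter (fun p => p.Prime ∧ ¬ p ∣ b),
    p ^ ((n + 1).factorization p) with hS
  set R := ∏ p ∈ (L a b n).primeFactors.filter (fun p => n < p),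
    p ^ ((L a b n).factorization p) with hR
  have hBp : ∀ p ∈ b.primeFactors.filter (· ≤ n), p.Prime := fun p hp =>
    Nat.prime_of_mem_primeFactors (mem_filter.mp hp).1
  have hSp : ∀ p ∈ (range (n + 1)).filter (fun p => p.Prime ∧ ¬ p ∣ b), p.Prime :=
    fun p hp => (mem_filter.mp hp).2.1
  have hRp : ∀ p ∈ (L a b n).primeFactors.filter (fun p => n < p), p.Prime := fun p hp =>
    Nat.prime_of_mem_primeFactors (mem_filter.mp hp).1
  have hP0 : P ≠ 0 := prod_ne_zero_iff.mpr fun k _ => by positivity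
  have hB0 : B ≠ 0 := prod_ne_zero_iff.mpr fun p hp => pow_ne_zero _ (hBp p hp).ne_zero
  have hS0 : S ≠ 0 := prod_ne_zero_iff.mpr fun p hp => pow_ne_zero _ (hSp p hp).ne_zero
  have hR0 : R ≠ 0 := prod_ne_zero_iff.mpr fun p hp => pow_ne_zero _ (hRp p hp).ne_zero
  have hn0 := n.factorial_ne_zero
  have key : n.factorial * S * R ∣ P * B := by
    rw [← Nat.factorization_prime_le_iff_dvd (by positivity) (by positivity)]
    intro p hp
    rw [Nat.factorization_mul (by positivity) hR0, Nat.factorization_mul hn0 hS0,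
      Nat.factorization_mul hP0 hB0]
    simp only [Finsupp.add_apply]
    rw [hB, hS, hR, factorization_prod_primes_pow _ hBp, factorization_prod_primes_pow _ hSp,
      factorization_prod_primes_pow _ hRp]
    simp only [mem_filter, mem_range, Nat.mem_primeFactors, hp, true_and]
    rcases lt_or_ge n p with hnp | hpn
    · have hfac : n.factorial.factorization p = 0 := Nat.factorization_factorial_eq_zero_of_lt hnp
      have hL : (L a b n).factorization p ≤ P.factorization p :=
        (Nat.factorization_le_iff_dvd (ne_zero_of_dvd_ne_zero hP0 (L_dvd_prod a b n)) hP0).mpr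
          (L_dvd_prod a b n) p
      rw [if_neg (by omega : ¬ (p < n + 1 ∧ ¬ p ∣ b)), hfac]
      split_ifs <;> omega
    · rw [if_neg (by omega : ¬ ((p ∣ L a b n ∧ L a b n ≠ 0) ∧ n < p))]
      by_cases hpb : p ∣ b
      · rw [if_neg fun h => h.2 hpb, if_pos ⟨⟨hpb, hb.ne'⟩, hpn⟩]
        omega
      · rw [if_pos ⟨by omega, hpb⟩, if_neg (by tauto)]
        have hle : (n + 1).factorial.factorization p ≤ P.factorization p := by
          rw [← hp.pow_dvd_iff_le_factorization hP0]
          exact dvd_prod_add_mul_of_dvd_factorial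
            (((hp.coprime_iff_not_dvd.mpr hpb).symm).pow_right _) (Nat.ordProj_dvd _ _)
        rw [Nat.factorial_succ, Nat.factorization_mul n.succ_ne_zero hn0] at hle
        simp only [Finsupp.add_apply, Nat.succ_eq_add_one] at hle
        omega
  exact ⟨(dvd_mul_right _ _).trans key, Nat.dvd_div_of_mul_dvd key⟩
end

section
/- For every integer b ≥ 3, we have ∏_{p prime, p ∣ b} p^(1/p) ≤ 1.57681 · log b. -/
/-- The product over `p ∈ s` of `p ^ ⌊n / p⌋` divides `n!`. -/
theorem prod_prime_pow_div_dvd_factorial {s : Finset ℕ} (hs : ∀ p ∈ s, p.Prime) (n : ℕ) :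
    ∏ p ∈ s, p ^ (n / p) ∣ n.factorial := by
  refine Finset.prod_dvd_of_isRelPrime (fun p hp q hq hpq => ?_) fun p hp => ?_
  · exact (Nat.coprime_iff_isRelPrime.1 <| Nat.Coprime.pow _ _ <|
      (Nat.coprime_primes (hs p hp) (hs q hq)).2 hpq)
  · have : Fact p.Prime := ⟨hs p hp⟩
    refine dvd_trans ?_ (Nat.factorial_dvd_factorial (Nat.mul_div_le n p))
    rw [padicValNat_dvd_iff_le (Nat.factorial_ne_zero _), padicValNat_factorial_mul]
    exact Nat.le_add_left _ _

theorem sum_log_primeFactors_le_log {b : ℕ} (hb : b ≠ 0) :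
    ∑ p ∈ b.primeFactors, Real.log p ≤ Real.log b := by
  have h0 : ∀ p ∈ b.primeFactors, (p : ℝ) ≠ 0 := fun p hp =>
    Nat.cast_ne_zero.2 (Nat.prime_of_mem_primeFactors hp).ne_zero
  rw [← Real.log_prod h0, ← Nat.cast_prod]
  refine Real.log_le_log ?_ ?_
  · exact_mod_cast Finset.prod_pos fun p hp => (Nat.prime_of_mem_primeFactors hp).pos
  · exact_mod_cast Nat.le_of_dvd (Nat.pos_of_ne_zero hb) (Nat.prod_primeFactors_dvd b)

theorem sum_log_div_primeFactors_le {b n : ℕ} (hb : b ≠ 0) (hn : 0 < n) :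
    ∑ p ∈ b.primeFactors, Real.log p / p ≤ (Real.log b + Real.log n.factorial) / n := by
  have hprime : ∀ p ∈ b.primeFactors, p.Prime := fun p hp => Nat.prime_of_mem_primeFactors hp
  have hfact : ∑ p ∈ b.primeFactors, ((n / p : ℕ) : ℝ) * Real.log p
      ≤ Real.log n.factorial := by
    have h0 : ∀ p ∈ b.primeFactors, ((p : ℝ) ^ (n / p)) ≠ 0 := fun p hp =>
      pow_ne_zero _ (Nat.cast_ne_zero.2 (hprime p hp).ne_zero)
    simp_rw [← Real.log_pow]
    rw [← Real.log_prod h0]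
    refine Real.log_le_log (Finset.prod_pos fun p hp =>
      pow_pos (Nat.cast_pos.2 (hprime p hp).pos) _) ?_
    exact_mod_cast Nat.le_of_dvd n.factorial_pos (prod_prime_pow_div_dvd_factorial hprime n)
  rw [le_div_iff₀ (Nat.cast_pos.2 hn), Finset.sum_mul]
  refine le_trans (Finset.sum_le_sum fun p hp => ?_)
    ((Finset.sum_add_distrib (f := fun p : ℕ => Real.log p)
      (g := fun p : ℕ => ((n / p : ℕ) : ℝ) * Real.log p)).trans_le
      (add_le_add (sum_log_primeFactors_le_log hb) hfact))
  have hlog : 0 ≤ Real.log p := Real.log_natCast_nonneg p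
  have hfloor : (n : ℝ) / p ≤ 1 + ((n / p : ℕ) : ℝ) := by
    rw [← Nat.floor_div_eq_div (K := ℝ), add_comm]
    exact (Nat.lt_floor_add_one _).le
  calc Real.log p / p * n = (n : ℝ) / p * Real.log p := by ring
    _ ≤ (1 + ((n / p : ℕ) : ℝ)) * Real.log p := by gcongr
    _ = _ := by ring

theorem sum_log_div_primeFactors_le_third {b : ℕ} (hb : b ≠ 0) :
    ∑ p ∈ b.primeFactors, Real.log p / p ≤ Real.log b / 3 + Real.log 2 / 6 := by
  have hterm : ∀ p ∈ b.primeFactors, Real.log p / p ≤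
      Real.log p / 3 + if p = 2 then Real.log 2 / 6 else 0 := by
    intro p hp
    split_ifs with h
    · subst h
      push_cast
      linarith
    · have h3 : 3 ≤ p :=
        lt_of_le_of_ne (Nat.prime_of_mem_primeFactors hp).two_le (Ne.symm h)
      rw [add_zero]
      exact div_le_div_of_nonneg_left (Real.log_natCast_nonneg p) (by norm_num)
        (by exact_mod_cast h3)
  refine (Finset.sum_le_sum hterm).trans ?_
  rw [Finset.sum_add_distrib, ← Finset.sum_div]
  refine add_le_add (by linarith [sum_log_primeFactors_le_log hb]) ?_
  rw [Finset.sum_ite_eq']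
  have := Real.log_nonneg (one_le_two (α := ℝ))
  split_ifs <;> linarith

theorem log_factorial_le_stirling {n : ℕ} (hn : 0 < n) :
    Real.log n.factorial ≤ n * Real.log n - n + 1 + Real.log n / 2 := by
  obtain ⟨m, rfl⟩ := Nat.exists_eq_succ_of_ne_zero hn.ne'
  have h := Stirling.log_stirlingSeq'_antitone (Nat.zero_le m)
  simp only [Function.comp_apply, Stirling.log_stirlingSeq_formula] at h
  have hm : ((m.succ : ℕ) : ℝ) ≠ 0 := by positivity
  rw [Real.log_mul two_ne_zero hm, Real.log_div hm (Real.exp_pos 1).ne', Real.log_exp] at h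
  norm_num at h
  push_cast at h ⊢
  linarith

theorem log_two_div_six_add_div_three_le {x : ℝ} (h₁ : Real.log 3 ≤ x) (h₂ : x ≤ 6) :
    Real.log 2 / 6 + x / 3 ≤ Real.log (1.57681 * x) := by
  have hlog2 := Real.log_two_gt_d9
  have hlog2' := Real.log_two_lt_d9
  have hlog3 := Real.log_three_gt_d9
  have hx1 : 1.0986 ≤ x := by linarith
  have hx0 : 0 < x := by linarith
  have hc : 0.405 ≤ Real.log 1.57681 := by
    have h : Real.log (3 / 2) ≤ Real.log 1.57681 := Real.log_le_log (by norm_num) (by norm_num)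
    rw [Real.log_div (by norm_num) (by norm_num)] at h
    linarith
  rw [Real.log_mul (by norm_num) hx0.ne']
  suffices x / 3 - 0.289 ≤ Real.log x by linarith
  rcases le_total x 2.5 with h | h
  · refine le_trans ?_ (Real.one_sub_inv_le_log_of_pos hx0)
    have : x⁻¹ ≤ 1.289 - x / 3 := by
      rw [inv_le_iff_one_le_mul₀ hx0]
      nlinarith
    linarith
  · have hlog := Real.one_sub_inv_le_log_of_pos (show 0 < x / 4 by positivity)
    rw [Real.log_div hx0.ne' (by norm_num), show (4 : ℝ) = 2 ^ 2 by norm_num, Real.log_pow] at hlog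
    push_cast at hlog
    have : (x / 2 ^ 2)⁻¹ ≤ 2.675 - x / 3 := by
      rw [inv_le_iff_one_le_mul₀ (by positivity)]
      nlinarith
    linarith

theorem sum_log_div_primeFactors_le_of_six_le {b : ℕ} (hb : 6 ≤ Real.log b) :
    ∑ p ∈ b.primeFactors, Real.log p / p ≤ Real.log (1.57681 * Real.log b) := by
  have hb0 : b ≠ 0 := by
    rintro rfl
    norm_num at hb
  set x := Real.log b
  have hx0 : 0 < x := by linarith
  obtain ⟨n, hn⟩ : ∃ n, n = ⌈x⌉₊ := ⟨_, rfl⟩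
  have hxn : x ≤ n := hn ▸ Nat.le_ceil x
  have hnx : (n : ℝ) < x + 1 := hn ▸ Nat.ceil_lt_add_one hx0.le
  have hn6 : (6 : ℝ) ≤ n := hb.trans hxn
  have hn0 : (0 : ℝ) < n := by linarith
  have hnpos : 0 < n := Nat.cast_pos.1 hn0
  have hmain := sum_log_div_primeFactors_le hb0 hnpos
  have hstir := log_factorial_le_stirling hnpos
  have hlogn : Real.log n ≤ n / 4 + 0.387 := by
    have h := Real.log_le_sub_one_of_pos (show (0 : ℝ) < n / 4 by positivity)
    rw [Real.log_div hn0.ne' (by norm_num), show (4 : ℝ) = 2 ^ 2 by norm_num, Real.log_pow] at h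
    have := Real.log_two_lt_d9
    push_cast at h
    norm_num at h ⊢
    linarith
  have hlogx : Real.log n + 1 - n / x ≤ Real.log x := by
    have h := Real.log_le_sub_one_of_pos (show (0 : ℝ) < n / x by positivity)
    rw [Real.log_div hn0.ne' hx0.ne'] at h
    linarith
  have hc : (0.3658 : ℝ) ≤ Real.log 1.57681 := by
    refine le_trans ?_ (Real.one_sub_inv_le_log_of_pos (by norm_num))
    norm_num
  rw [Real.log_mul (by norm_num) hx0.ne']
  refine hmain.trans (le_trans ?_ (add_le_add hc hlogx))
  have hfact : Real.log n.factorial / n ≤ Real.log n - 1 + 1 / 8 + 1.1935 / n := by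
    rw [div_le_iff₀ hn0, add_mul, div_mul_cancel₀ _ hn0.ne']
    linarith
  have hinv : 1.1935 / (n : ℝ) ≤ 1.1935 / 6 := by gcongr
  have hratio : x / n + n / x ≤ 2 + 1 / 30 := by
    rw [div_add_div _ _ hn0.ne' hx0.ne', div_le_iff₀ (by positivity)]
    nlinarith
  rw [add_div]
  linarith

open Finset in
theorem prod_prime_root_bound (b : ℕ) (hb : 3 ≤ b) :
    ∏ p ∈ b.primeFactors, (p : ℝ) ^ ((1 : ℝ) / p) ≤ 1.57681 * Real.log b := by
  have hlog3 : Real.log 3 ≤ Real.log b :=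
    Real.log_le_log (by norm_num) (by exact_mod_cast hb)
  have hpos : 0 < Real.log b := (Real.log_pos (by norm_num)).trans_le hlog3
  have hprod : ∏ p ∈ b.primeFactors, (p : ℝ) ^ ((1 : ℝ) / p) =
      Real.exp (∑ p ∈ b.primeFactors, Real.log p / p) := by
    rw [Real.exp_sum]
    refine prod_congr rfl fun p hp => ?_
    rw [Real.rpow_def_of_pos (Nat.cast_pos.2 (Nat.prime_of_mem_primeFactors hp).pos),
      mul_one_div]
  rw [hprod, ← Real.le_log_iff_exp_le (by positivity)]
  rcases le_total (Real.log b) 6 with h | h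
  · have := sum_log_div_primeFactors_le_third (b := b) (by omega)
    linarith [log_two_div_six_add_div_three_le hlog3 h]
  · exact sum_log_div_primeFactors_le_of_six_le h
end

section
/- Let a and b be coprime positive integers, let n ≥ 2 be an integer, and let q be a prime number with q ≤ n and q ∤ b. Then ϑ_q( a(a+b)(a+2b)···(a+nb) ) ≥ ϑ_q( (n+1)! ). -/
/-- A divisor of `m !` coprime to the common difference divides every product of `m` consecutive
terms of an arithmetic progression. -/
theorem dvd_prod_range_add_mul_of_dvd_factorial {N m b : ℕ} (a : ℕ) (hN : N.Coprime b)
    (h : N ∣ m.factorial) : N ∣ ∏ k ∈ Finset.range m, (a + k * b) := by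
  have hpos : 0 < N := Nat.pos_of_dvd_of_pos h m.factorial_pos
  obtain ⟨c, hc, hbc⟩ : ∃ c, N.Coprime c ∧ b * c ≡ 1 [MOD N] := by
    refine ⟨b ^ (N.totient - 1), hN.pow_right _, ?_⟩
    rw [mul_pow_sub_one (Nat.totient_pos.2 hpos).ne']
    exact Nat.ModEq.pow_totient hN.symm
  refine (hc.pow_right m).dvd_of_dvd_mul_left ?_
  have key : c ^ m * ∏ k ∈ Finset.range m, (a + k * b) ≡
      ∏ k ∈ Finset.range m, (a * c + k) [MOD N] := by
    rw [← ZMod.natCast_eq_natCast_iff] at hbc ⊢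
    push_cast at hbc ⊢
    rw [← Finset.card_range m, ← Finset.prod_const, Finset.card_range, ← Finset.prod_mul_distrib]
    exact Finset.prod_congr rfl fun k _ => by linear_combination (k : ZMod N) * hbc
  rw [key.dvd_iff dvd_rfl, ← Nat.ascFactorial_eq_prod_range]
  exact h.trans (Nat.factorial_dvd_ascFactorial _ _)

open Finset in
theorem valuation_prod_ap_ge (a b : ℕ) (ha : 0 < a) (hb : 0 < b)
    (hcop : Nat.Coprime a b) (n : ℕ) (hn : 2 ≤ n) (q : ℕ) (hq : q.Prime)
    (hqn : q ≤ n) (hqb : ¬ q ∣ b) :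
    ((n + 1).factorial).factorization q ≤
      (∏ k ∈ Finset.range (n + 1), (a + k * b)).factorization q := by
  have hne : ∏ k ∈ Finset.range (n + 1), (a + k * b) ≠ 0 :=
    Finset.prod_ne_zero_iff.2 fun k _ => by positivity
  rw [← hq.pow_dvd_iff_le_factorization hne]
  exact dvd_prod_range_add_mul_of_dvd_factorial a
    (((Nat.Prime.coprime_iff_not_dvd hq).2 hqb).pow_left _) (Nat.ordProj_dvd _ _)
end

section
/- Let ℓ and k be positive integers and x a positive real number, and set m := ⌊x/k⌋. Then θ(x; k, ℓ) ≤ log L_{ℓ,k,m}, i.e., the sum of log p over the primes p ≤ x with p ≡ ℓ (mod k) is at most the logarithm of lcm(ℓ, ℓ+k, …, ℓ+mk). -/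
open Finset in
theorem prod_arith_dvd_factorial_mul (k N : ℕ) (n : ℕ) : ∀ a : ℕ,
    (∀ i ≤ n, a + i * k ∣ N) →
    (∏ i ∈ range (n + 1), (a + i * k)) ∣ n.factorial * k ^ n * N := by
  induction n with
  | zero => intro a h; simpa using h 0 le_rfl
  | succ n ih =>
    intro a h
    obtain ⟨u, hu⟩ := ih a (fun i hi => h i (by omega))
    obtain ⟨v, hv⟩ := ih (a + k) (fun i hi => by
      have := h (i + 1) (by omega)
      rwa [show a + (i + 1) * k = a + k + i * k by ring] at this)
    have h0 := prod_range_succ (fun i => a + i * k) (n + 1)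
    have h1 := prod_range_succ' (fun i => a + i * k) (n + 1)
    have h2 : ∏ i ∈ range (n + 1), (a + (i + 1) * k) = ∏ i ∈ range (n + 1), (a + k + i * k) :=
      prod_congr rfl fun i _ => by ring
    rw [h2] at h1
    set Q := ∏ i ∈ range (n + 1 + 1), (a + i * k)
    set A := ∏ i ∈ range (n + 1), (a + i * k)
    set B := ∏ i ∈ range (n + 1), (a + k + i * k)
    rw [← Int.natCast_dvd_natCast]
    refine ⟨(u : ℤ) - v, ?_⟩
    rw [Nat.factorial_succ, pow_succ]
    zify at hu hv h0 h1
    push_cast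
    linear_combination (a + (n + 1) * k : ℤ) * hu - (a : ℤ) * hv - (u : ℤ) * h0 + (v : ℤ) * h1

theorem Nat.exists_eq_coprime_mul_dvd_pow (k : ℕ) (n : ℕ) (hn : 0 < n) :
    ∃ F G s : ℕ, n = F * G ∧ F.Coprime k ∧ G ∣ k ^ s := by
  induction n using Nat.strong_induction_on with
  | _ n ih =>
    by_cases hg : n.gcd k = 1
    · exact ⟨n, 1, 0, by simp, hg, by simp⟩
    · obtain ⟨c, hc⟩ := Nat.gcd_dvd_left n k
      have hgpos : 0 < n.gcd k := Nat.gcd_pos_of_pos_left k hn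
      have hcpos : 0 < c := by
        rcases Nat.eq_zero_or_pos c with rfl | h
        · omega
        · exact h
      have hlt : c < n := by
        have : 2 * c ≤ n.gcd k * c := Nat.mul_le_mul_right c (by omega)
        omega
      obtain ⟨F, G, s, h1, h2, h3⟩ := ih c hlt hcpos
      refine ⟨F, n.gcd k * G, s + 1, ?_, h2, ?_⟩
      · calc n = n.gcd k * c := hc
          _ = F * (n.gcd k * G) := by rw [h1]; ring
      · rw [pow_succ']
        exact Nat.mul_dvd_mul (Nat.gcd_dvd_right n k) h3

open Finset in
theorem dvd_prod_arith_of_dvd_factorial (r k t F : ℕ) (hF : F.Coprime k)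
    (hFt : F ∣ t.factorial) : F ∣ ∏ i ∈ range t, (r + i * k) := by
  rcases Nat.eq_zero_or_pos F with rfl | hpos
  · exact absurd (Nat.eq_zero_of_zero_dvd hFt) (Nat.factorial_ne_zero t)
  have : NeZero F := ⟨hpos.ne'⟩
  have hu : IsUnit (k : ZMod F) := (ZMod.isUnit_iff_coprime k F).2 hF.symm
  obtain ⟨u, hu⟩ := hu
  obtain ⟨c, hc⟩ : ∃ c : ℕ, (c : ZMod F) = r * ((u⁻¹ : (ZMod F)ˣ) : ZMod F) :=
    ⟨_, ZMod.natCast_zmod_val _⟩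
  rw [← ZMod.natCast_eq_zero_iff]
  have hr : (r : ZMod F) = c * k := by
    rw [hc, ← hu, mul_assoc, Units.inv_mul, mul_one]
  have key : ((∏ i ∈ range t, (r + i * k) : ℕ) : ZMod F)
      = ((c.ascFactorial t : ℕ) : ZMod F) * (k : ZMod F) ^ t := by
    rw [Nat.ascFactorial_eq_prod_range]
    push_cast
    rw [← card_range t, ← prod_const, card_range, ← prod_mul_distrib]
    exact prod_congr rfl fun i _ => by rw [hr]; ring
  rw [key, (ZMod.natCast_eq_zero_iff _ _).2 (hFt.trans (Nat.factorial_dvd_ascFactorial c t)),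
    zero_mul]

open Finset in
theorem centralBinom_mul_prod_arith_le (r k t s : ℕ) (hr : r ≤ k) (hs : t ≤ s) :
    t.centralBinom * ∏ i ∈ range t, (r + i * k) ≤ ∏ i ∈ range t, (r + (s + i) * k) := by
  have h1 : t.factorial * t.centralBinom = ∏ i ∈ range t, (t + 1 + i) := by
    rw [← Nat.ascFactorial_eq_prod_range, Nat.ascFactorial_eq_factorial_mul_choose,
      Nat.centralBinom_eq_two_mul_choose, two_mul]
  have h2 : t.factorial = ∏ i ∈ range t, (i + 1) := (prod_range_add_one_eq_factorial t).symm
  refine Nat.le_of_mul_le_mul_left ?_ t.factorial_pos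
  rw [← mul_assoc, h1, h2, ← prod_mul_distrib, ← prod_mul_distrib]
  refine prod_le_prod' fun i _ => ?_
  have h3 : t * r ≤ t * k := Nat.mul_le_mul_left t hr
  have h4 : (i + 1) * (t * k) ≤ (i + 1) * (s * k) :=
    Nat.mul_le_mul_left _ (Nat.mul_le_mul_right k hs)
  nlinarith

open Finset in
theorem two_mul_primorial_le_centralBinom (n : ℕ) (hn : 0 < n) :
    2 * primorial n ≤ n.centralBinom := by
  induction n using Nat.strong_induction_on with
  | _ n ih =>
    rcases Nat.even_or_odd' n with ⟨c, rfl | rfl⟩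
    · rcases Nat.lt_or_ge c 2 with hc | hc
      · obtain rfl : c = 1 := by omega
        decide
      · have hnp : ¬ (2 * c).Prime := fun h => by
          have := (Nat.prime_dvd_prime_iff_eq Nat.prime_two h).1 ⟨c, rfl⟩
          omega
        obtain ⟨d, hd⟩ : ∃ d, 2 * c = d + 1 := ⟨2 * c - 1, by omega⟩
        rw [hd] at hnp ih ⊢
        have h1 : primorial (d + 1) = primorial d := by
          unfold primorial
          rw [range_add_one (n := d + 1), filter_insert, if_neg hnp]
        rw [h1]
        exact (ih d (by omega) (by omega)).trans (Nat.centralBinom_strictMono.monotone (by omega))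
    · rcases Nat.eq_zero_or_pos c with rfl | hc
      · decide
      · have h1 := ih (c + 1) (by omega) (by omega)
        have h2 : (c + 1).centralBinom = 2 * (2 * c + 1).choose c := by
          rw [Nat.centralBinom_eq_two_mul_choose, show 2 * (c + 1) = 2 * c + 1 + 1 by ring,
            Nat.choose_succ_succ', Nat.choose_symm_half]
          ring
        have h3 : primorial (2 * c + 1) ≤ (2 * c + 1).choose c * primorial (c + 1) := by
          have := primorial_add_le (m := c + 1) (n := c) (by omega)
          rw [show c + 1 + c = 2 * c + 1 by ring, Nat.choose_symm_half] at this
          linarith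
        have h4 : 2 * ((2 * c + 1).choose c) ^ 2 ≤ (2 * c + 1).centralBinom := by
          rw [Nat.centralBinom_eq_two_mul_choose, ← Nat.sum_range_choose_sq]
          have hsub : ({c, c + 1} : Finset ℕ) ⊆ range (2 * c + 1 + 1) := by
            intro i hi
            simp only [mem_insert, mem_singleton] at hi
            simp only [mem_range]
            omega
          refine le_trans (le_of_eq ?_) (sum_le_sum_of_subset hsub)
          rw [sum_pair (by omega), Nat.choose_symm_half]
          ring
        nlinarith

theorem exists_dvd_arith_of_coprime (l k p : ℕ) (hp : 0 < p) (hpk : p.Coprime k) :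
    ∃ i < p, p ∣ l + i * k := by
  have : NeZero p := ⟨hp.ne'⟩
  obtain ⟨u, hu⟩ := (ZMod.isUnit_iff_coprime k p).2 hpk.symm
  refine ⟨(-(l : ZMod p) * ((u⁻¹ : (ZMod p)ˣ) : ZMod p)).val, ZMod.val_lt _, ?_⟩
  rw [← ZMod.natCast_eq_zero_iff]
  push_cast
  rw [ZMod.natCast_zmod_val, ← hu, mul_assoc, Units.inv_mul]
  ring

theorem dvd_L (a b n i : ℕ) (hi : i ≤ n) : a + i * b ∣ L a b n :=
  Finset.dvd_lcm (f := fun k => a + k * b) (Finset.mem_range.2 (by omega))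

theorem L_pos (a b n : ℕ) (ha : 0 < a) : 0 < L a b n := by
  refine Nat.pos_of_ne_zero fun h => ?_
  obtain ⟨i, -, hi⟩ := Finset.lcm_eq_zero_iff.1 h
  simp only [Nat.add_eq_zero_iff] at hi
  omega

open Finset in
/-- The case of a start `r + q * k` that is large compared with the number of terms. -/
theorem prod_primes_le_L_of_lt (r k q m : ℕ) (S : Finset ℕ) (hr : 0 < r) (hrk : r ≤ k)
    (hcop : r.Coprime k) (hq : 0 < q) (hm : m < r + q * k)
    (hS : ∀ p ∈ S, p.Prime ∧ ∃ j ≤ m, p = r + j * k) :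
    ∏ p ∈ S, p ≤ L (r + q * k) k m := by
  have hk : 0 < k := by omega
  obtain ⟨n, hn⟩ : ∃ n, min q (m + 1) = n + 1 := ⟨min q (m + 1) - 1, by omega⟩
  obtain ⟨s, hs⟩ : ∃ s, s = max q (m + 1) := ⟨_, rfl⟩
  have hLpos := L_pos (r + q * k) k m (by omega)
  obtain ⟨F, G, e, hFG, hFk, hG⟩ :=
    Nat.exists_eq_coprime_mul_dvd_pow k n.factorial n.factorial_pos
  have hFn : F ∣ n.factorial := ⟨G, hFG⟩
  have hFpos : 0 < F := Nat.pos_of_dvd_of_pos hFn n.factorial_pos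
  set X := ∏ i ∈ range (n + 1), (r + (s + i) * k) with hX
  set Y := ∏ i ∈ range (n + 1), (r + i * k) with hY
  have hXY : (n + 1).centralBinom * Y ≤ X :=
    centralBinom_mul_prod_arith_le r k (n + 1) s hrk (by omega)
  set T := (range (n + 1)).lcm fun i => r + (s + i) * k with hT
  have hTL : T ∣ L (r + q * k) k m := by
    refine Finset.lcm_dvd fun i hi => ?_
    rw [mem_range] at hi
    have := dvd_L (r + q * k) k m (s + i - q) (by omega)
    rwa [add_assoc, ← add_mul, show q + (s + i - q) = s + i by omega] at this
  have hXk : X.Coprime k := by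
    refine Nat.Coprime.prod_left fun i _ => ?_
    simpa using hcop
  have hXF : X ∣ F * T := by
    have h1 := prod_arith_dvd_factorial_mul k T n (r + s * k) (fun i hi => by
      rw [add_assoc, ← add_mul]
      exact Finset.dvd_lcm (f := fun i => r + (s + i) * k) (mem_range.2 (by omega)))
    have h2 : ∏ i ∈ range (n + 1), (r + s * k + i * k) = X :=
      prod_congr rfl fun i _ => by ring
    rw [h2, hFG, show F * G * k ^ n * T = (F * T) * (G * k ^ n) by ring] at h1
    refine Nat.Coprime.dvd_of_dvd_mul_right ?_ h1
    exact Nat.Coprime.mul_right ((hXk.pow_right e).coprime_dvd_right hG) (hXk.pow_right n)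
  have hTX : T ∣ X := Finset.lcm_dvd fun i hi => dvd_prod_of_mem _ hi
  have hTpos : 0 < T := Nat.pos_of_dvd_of_pos hTL hLpos
  have hXle : X ≤ F * T := Nat.le_of_dvd (Nat.mul_pos hFpos hTpos) hXF
  set D := ∏ p ∈ S with r + (n + 1) * k ≤ p, p with hD
  set M := ∏ p ∈ S with (¬ r + (n + 1) * k ≤ p) ∧ n < p, p with hM
  set E := ∏ p ∈ S with (¬ r + (n + 1) * k ≤ p) ∧ ¬ n < p, p with hE
  have hsplit : ∏ p ∈ S, p = D * (M * E) := by
    rw [← prod_filter_mul_prod_filter_not S (fun p => r + (n + 1) * k ≤ p),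
      ← prod_filter_mul_prod_filter_not (S.filter fun p => ¬ r + (n + 1) * k ≤ p) (fun p => n < p),
      filter_filter, filter_filter]
  have hDidx : ∀ p ∈ S, r + (n + 1) * k ≤ p → ∃ j, q ≤ j ∧ j ≤ m ∧ q = n + 1 ∧ p = r + j * k := by
    intro p hp hle
    obtain ⟨-, j, hj, rfl⟩ := hS p hp
    have : n + 1 ≤ j := Nat.le_of_mul_le_mul_right (by omega) hk
    exact ⟨j, by omega, hj, by omega, rfl⟩
  have hDL : D ∣ L (r + q * k) k m := by
    refine prod_primes_dvd _ (fun p hp => (hS p (mem_filter.1 hp).1).1.prime) fun p hp => ?_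
    obtain ⟨hpS, hle⟩ := mem_filter.1 hp
    obtain ⟨j, hqj, hjm, -, rfl⟩ := hDidx p hpS hle
    have := dvd_L (r + q * k) k m (j - q) (by omega)
    rwa [add_assoc, ← add_mul, show q + (j - q) = j by omega] at this
  have hDX : D.Coprime X := by
    refine Nat.Coprime.prod_left fun p hp => Nat.Coprime.prod_right fun i hi => ?_
    obtain ⟨hpS, hle⟩ := mem_filter.1 hp
    obtain ⟨j, hqj, hjm, hqn, hpj⟩ := hDidx p hpS hle
    have hpp := (hS p hpS).1
    rw [mem_range] at hi
    rw [hpp.coprime_iff_not_dvd]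
    intro hdvd
    have hdiff : r + (s + i) * k = p + (s + i - j) * k := by
      rw [hpj, add_assoc, ← add_mul, show j + (s + i - j) = s + i by omega]
    rw [hdiff, Nat.dvd_add_right (dvd_refl p)] at hdvd
    have hpk : p.Coprime k := by rw [hpj]; simpa using hcop
    have h1 := Nat.le_of_dvd (by omega) (hpk.dvd_of_dvd_mul_right hdvd)
    rw [← hqn] at hle
    omega
  have hDT : D * T ≤ L (r + q * k) k m :=
    Nat.le_of_dvd hLpos ((hDX.coprime_dvd_right hTX).mul_dvd_of_dvd_of_dvd hDL hTL)
  have hMY : M ∣ Y := by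
    refine prod_primes_dvd _ (fun p hp => (hS p (mem_filter.1 hp).1).1.prime) fun p hp => ?_
    obtain ⟨hpS, hlt, -⟩ := mem_filter.1 hp
    obtain ⟨-, j, hj, rfl⟩ := hS p hpS
    have : j < n + 1 := by
      by_contra! h
      exact hlt (by have := Nat.mul_le_mul_right k h; omega)
    exact dvd_prod_of_mem (fun i => r + i * k) (mem_range.2 this)
  have hMF : M.Coprime F := by
    refine Nat.Coprime.prod_left fun p hp => ?_
    obtain ⟨hpS, -, hlt⟩ := mem_filter.1 hp
    have hpp := (hS p hpS).1
    refine Nat.Coprime.coprime_dvd_right hFn ?_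
    exact (Nat.coprime_factorial_iff hpp.ne_one).2 (by rwa [hpp.minFac_eq])
  have hFY : F ∣ Y := dvd_prod_arith_of_dvd_factorial r k (n + 1) F hFk
    (hFn.trans (Nat.factorial_dvd_factorial (by omega)))
  have hYpos : 0 < Y := prod_pos fun i _ => by omega
  have hMFY : M * F ≤ Y := Nat.le_of_dvd hYpos (hMF.mul_dvd_of_dvd_of_dvd hMY hFY)
  have hEle : E ≤ (n + 1).centralBinom := by
    have h1 : E ≤ primorial (n + 1) := by
      refine prod_le_prod_of_subset_of_one_le' (fun p hp => ?_) fun p hp _ => ?_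
      · obtain ⟨hpS, -, hlt⟩ := mem_filter.1 hp
        exact mem_filter.2 ⟨mem_range.2 (by omega), (hS p hpS).1⟩
      · exact (mem_filter.1 hp).2.one_le
    have := two_mul_primorial_le_centralBinom (n + 1) (by omega)
    omega
  have hME : M * E ≤ T := by
    refine Nat.le_of_mul_le_mul_left ?_ hFpos
    calc F * (M * E) = E * (M * F) := by ring
      _ ≤ (n + 1).centralBinom * Y := Nat.mul_le_mul hEle hMFY
      _ ≤ X := hXY
      _ ≤ F * T := hXle
  rw [hsplit]
  exact (Nat.mul_le_mul_left D hME).trans hDT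

open Finset in
theorem prod_primes_le_L (l k N : ℕ) (hl : 0 < l) (hk : 0 < k) :
    ∏ p ∈ (range (N + 1)).filter (fun p => p.Prime ∧ p % k = l % k), p ≤ L l k (N / k) := by
  have of_dvd (h : ∀ p ≤ N, p.Prime → p % k = l % k → p ∣ L l k (N / k)) :
      ∏ p ∈ (range (N + 1)).filter (fun p => p.Prime ∧ p % k = l % k), p ≤ L l k (N / k) := by
    refine Nat.le_of_dvd (L_pos l k _ hl) (prod_primes_dvd _ (fun p hp => ?_) fun p hp => ?_)
    · exact (mem_filter.1 hp).2.1.prime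
    · obtain ⟨h1, h2, h3⟩ := mem_filter.1 hp
      exact h p (by rw [mem_range] at h1; omega) h2 h3
  have of_le (p : ℕ) (hpN : p ≤ N) (hpl : p % k = l % k) (hlp : l ≤ p) : p ∣ L l k (N / k) := by
    obtain ⟨j, hj⟩ := (Nat.modEq_iff_dvd' hlp).1 (show l ≡ p [MOD k] from hpl.symm)
    have hpj : p = l + j * k := by rw [mul_comm]; omega
    rw [hpj]
    exact dvd_L l k _ j ((Nat.le_div_iff_mul_le hk).2 (by omega))
  have hgcd (p : ℕ) (hpl : p % k = l % k) : p.gcd k = l.gcd k :=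
    Nat.ModEq.gcd_eq (show p ≡ l [MOD k] from hpl)
  by_cases hcop : l.Coprime k
  swap
  · refine of_dvd fun p _ hp hpl => ?_
    have h1 : p.gcd k = p :=
      ((Nat.dvd_prime hp).1 (Nat.gcd_dvd_left p k)).resolve_left
        (fun h => hcop ((hgcd p hpl).symm.trans h))
    have h2 : p ∣ l := by
      rw [← h1, hgcd p hpl]
      exact Nat.gcd_dvd_left l k
    exact h2.trans (by simpa using dvd_L l k (N / k) 0 (Nat.zero_le _))
  rcases Nat.lt_or_ge (N / k) l with hml | hml
  swap
  · refine of_dvd fun p hpN hp hpl => ?_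
    rcases Nat.lt_or_ge p l with hlt | hge
    · obtain ⟨i, hi, hdvd⟩ := exists_dvd_arith_of_coprime l k p hp.pos ((hgcd p hpl).trans hcop)
      exact hdvd.trans (dvd_L l k _ i (by omega))
    · exact of_le p hpN hpl hge
  obtain ⟨q, r, hr, hrk, rfl⟩ : ∃ q r, 0 < r ∧ r ≤ k ∧ l = r + q * k := by
    refine ⟨(l - 1) / k, (l - 1) % k + 1, Nat.succ_pos _, Nat.mod_lt _ hk, ?_⟩
    have := Nat.mod_add_div (l - 1) k
    rw [mul_comm ((l - 1) / k)]
    omega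
  have hidx (p : ℕ) (hp : p.Prime) (hpl : p % k = (r + q * k) % k) : r ≤ p := by
    by_contra! hlt
    rw [Nat.add_mul_mod_self_right, Nat.mod_eq_of_lt (by omega)] at hpl
    rcases hrk.lt_or_eq with h | rfl
    · rw [Nat.mod_eq_of_lt h] at hpl
      omega
    · rw [Nat.mod_self] at hpl
      exact hp.ne_zero hpl
  rcases Nat.eq_zero_or_pos q with rfl | hq
  · exact of_dvd fun p hpN hp hpl => of_le p hpN hpl (by simpa using hidx p hp hpl)
  refine prod_primes_le_L_of_lt r k q (N / k) _ hr hrk (by simpa using hcop) hq hml ?_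
  intro p hp
  obtain ⟨h1, h2, h3⟩ := mem_filter.1 hp
  refine ⟨h2, ?_⟩
  have hrp := hidx p h2 h3
  rw [Nat.add_mul_mod_self_right] at h3
  obtain ⟨j, hj⟩ := (Nat.modEq_iff_dvd' hrp).1 (show r ≡ p [MOD k] from h3.symm)
  have hpj : p = r + j * k := by rw [mul_comm]; omega
  rw [mem_range] at h1
  exact ⟨j, (Nat.le_div_iff_mul_le hk).2 (by omega), hpj⟩

theorem theta_le_log_lcm (l k : ℕ) (hl : 0 < l) (hk : 0 < k) (x : ℝ)
    (hx : 0 < x) :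
    theta x k l ≤ Real.log (L l k (Nat.floor (x / k))) := by
  have hne : ∀ p ∈ (Finset.range (Nat.floor x + 1)).filter
      (fun p => p.Prime ∧ p % k = l % k), (p : ℝ) ≠ 0 := fun p hp =>
    Nat.cast_ne_zero.2 (Finset.mem_filter.1 hp).2.1.ne_zero
  rw [theta, ← Real.log_prod hne, Nat.floor_div_natCast, ← Nat.cast_prod]
  refine Real.log_le_log ?_ (Nat.cast_le.2 (prod_primes_le_L l k ⌊x⌋₊ hl hk))
  exact Nat.cast_pos.2 (Finset.prod_pos fun p hp => (Finset.mem_filter.1 hp).2.1.pos)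
end
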